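/- Let (R,m) be an excellent Noetherian local ring of dimension at least 2 that is equidimensional and has no embedded primes, and let M be an Artinian R-module. Then there exist a free R-module F and submodules L ⊆ T ⊆ F such that M ≅ T/L and T ⊆ L⁻_F (that is, T is integral over L in F); in particular L and T are torsionless. Moreover, if M is finitely generated (hence of finite length), then F, T, and L may be chosen finitely generated. -/

import Mathlib

/- # Liftable integral closure: core definitions

Free $R$-modules are modeled as `ι →₀ R`, and the symmetric algebra of `ι →₀ R`
is modeled as `MvPolynomial ι R`, with the canonical degree-one embedding sending
the basis vector at `i` to the variable `X i`. -/

noncomputable section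

open scoped TensorProduct

namespace LIC

variable (R : Type*) [CommRing R]

/-- The canonical embedding of the free module `ι →₀ R` onto the degree-one part of its
symmetric algebra `MvPolynomial ι R`. -/
def symEmb (ι : Type*) : (ι →₀ R) →ₗ[R] MvPolynomial ι R :=
  Finsupp.linearCombination R MvPolynomial.X

variable {R}

/-- The integral closure `U⁻_F` of a submodule `U` of the free module `F = ι →₀ R`:
the degree-one part of the integral closure, inside the symmetric algebra of `F`,
of the subalgebra generated by `U`. -/
def freeIC {ι : Type*} (U : Submodule R (ι →₀ R)) : Submodule R (ι →₀ R) where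
  carrier := {x | IsIntegral (Algebra.adjoin R (symEmb R ι '' U)) (symEmb R ι x)}
  zero_mem' := by simpa using isIntegral_zero
  add_mem' := by
    intro a b ha hb
    simpa [map_add] using ha.add hb
  smul_mem' := by
    intro c x hx
    have hc : IsIntegral (Algebra.adjoin R (symEmb R ι '' ↑U))
        ((algebraMap R (MvPolynomial ι R)) c) := by
      have : (algebraMap R (MvPolynomial ι R)) c
          = algebraMap (Algebra.adjoin R (symEmb R ι '' ↑U)) (MvPolynomial ι R)
            ⟨(algebraMap R (MvPolynomial ι R)) c,
              Subalgebra.algebraMap_mem _ c⟩ := rfl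
      rw [this]
      exact isIntegral_algebraMap
    have : symEmb R ι (c • x) = (algebraMap R (MvPolynomial ι R)) c * symEmb R ι x := by
      rw [map_smul, Algebra.smul_def]
    simpa [Set.mem_setOf_eq, this] using hc.mul hx
  
/-- The liftable integral closure `lic(L, M)` of a submodule `L ⊆ M`, computed via the
canonical free presentation `M →₀ R ↠ M`.  (By `LIC.lic_indep` this agrees with the
closure computed from any surjection of a free module onto `M`.) -/
def lic {M : Type*} [AddCommGroup M] [Module R M] (L : Submodule R M) : Submodule R M :=
  Submodule.map (Finsupp.linearCombination R (id : M → M))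
    (freeIC (Submodule.comap (Finsupp.linearCombination R (id : M → M)) L))

end LIC

end

namespace LIC

open scoped TensorProduct

/-- A regular local ring: a Noetherian local ring whose maximal ideal can be generated by
`dim R` elements. -/
def IsRegularLocalRing (A : Type*) [CommRing A] : Prop :=
  IsNoetherianRing A ∧ ∃ _ : IsLocalRing A, ∃ s : Finset A,
    Ideal.span (s : Set A) = IsLocalRing.maximalIdeal A ∧
    (s.card : WithBot ℕ∞) = ringKrullDim A

/-- A regular ring: all localizations at primes are regular local rings. -/
def IsRegularRing (A : Type*) [CommRing A] : Prop :=
  ∀ (q : Ideal A) (_ : q.IsPrime), IsRegularLocalRing (Localization.AtPrime q)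

universe v

/-- An `R`-algebra `S` has geometrically regular fibers if for every prime `p ⊆ R` and
every finite field extension `K` of the residue field `κ(p) = Frac(R/p)`, the
base-changed fiber `K ⊗_R S` is a regular ring. -/
def HasGeometricallyRegularFibers (R : Type*) (S : Type*) [CommRing R] [CommRing S]
    [Algebra R S] : Prop :=
  ∀ (p : Ideal R) (_ : p.IsPrime)
    (K : Type v) (_ : Field K) (_ : Algebra (R ⧸ p) K) (_ : NoZeroSMulDivisors (R ⧸ p) K)
    (_ : Algebra R K) (_ : IsScalarTower R (R ⧸ p) K),
    (letI := FractionRing.liftAlgebra (R ⧸ p) K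
     FiniteDimensional (FractionRing (R ⧸ p)) K) →
    IsRegularRing (K ⊗[R] S)

/-- A catenary ring: any two saturated chains of primes with the same endpoints have the
same length. -/
def IsCatenaryRing (A : Type*) [CommRing A] : Prop :=
  ∀ c d : LTSeries (PrimeSpectrum A),
    c.head = d.head → c.last = d.last →
    (∀ i : Fin c.length, c.toFun i.castSucc ⋖ c.toFun i.succ) →
    (∀ i : Fin d.length, d.toFun i.castSucc ⋖ d.toFun i.succ) →
    c.length = d.length

universe u

/-- A G-ring: for every prime `p`, the formal fibers of `R_p` (the fibers of the map from
`R_p` to its maximal-adic completion) are geometrically regular. -/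
def IsGRing (R : Type u) [CommRing R] : Prop :=
  ∀ (p : Ideal R) (_ : p.IsPrime),
    HasGeometricallyRegularFibers.{u} (Localization.AtPrime p)
      (AdicCompletion (IsLocalRing.maximalIdeal (Localization.AtPrime p))
        (Localization.AtPrime p))

/-- J-2: for every finite-type `R`-algebra, the regular locus of its prime spectrum is
open. -/
def IsJ2 (R : Type u) [CommRing R] : Prop :=
  ∀ (A : Type u) (_ : CommRing A) (_ : Algebra R A), Algebra.FiniteType R A →
    IsOpen {q : PrimeSpectrum A | IsRegularLocalRing (Localization.AtPrime q.asIdeal)}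

/-- Universally catenary: every finite-type `R`-algebra is catenary. -/
def IsUniversallyCatenary (R : Type u) [CommRing R] : Prop :=
  ∀ (A : Type u) (_ : CommRing A) (_ : Algebra R A), Algebra.FiniteType R A →
    IsCatenaryRing A

/-- An excellent ring: a universally catenary Noetherian G-ring satisfying J-2. -/
def IsExcellentRing (R : Type u) [CommRing R] : Prop :=
  IsNoetherianRing R ∧ IsUniversallyCatenary R ∧ IsGRing R ∧ IsJ2 R

open CategoryTheory in
/-- A Gorenstein local ring: a Noetherian local ring having finite injective dimension
over itself, i.e. admitting a finite-length injective resolution of itself. -/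
def IsGorensteinLocalRing (S : Type u) [CommRing S] : Prop :=
  IsNoetherianRing S ∧ IsLocalRing S ∧
  ∃ (I : InjectiveResolution (ModuleCat.of S S)) (n : ℕ),
    ∀ m, n ≤ m → Limits.IsZero (I.cocomplex.X m)

/-- A local ring is equidimensional if `dim (R/p) = dim R` for every minimal prime `p`. -/
def IsEquidimensionalRing (R : Type*) [CommRing R] : Prop :=
  ∀ p ∈ minimalPrimes R, ringKrullDim (R ⧸ p) = ringKrullDim R

/-- A ring has no embedded primes if every associated prime (of `R` as a module over
itself) is a minimal prime. -/
def HasNoEmbeddedPrimes (R : Type*) [CommRing R] : Prop :=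
  ∀ p : Ideal R, IsAssociatedPrime p R → p ∈ minimalPrimes R

end LIC

universe u

section
theorem reg_dom (d : ℕ) : ∀ (A : Type*) [CommRing A] [IsLocalRing A] [IsNoetherianRing A]
    (g : Fin d → A), Ideal.span (Set.range g) = IsLocalRing.maximalIdeal A →
    (d : WithBot ℕ∞) ≤ ringKrullDim A → IsDomain A := by
  induction d with
  | zero =>
    intro A _ _ _ g hg _
    have h0 : IsLocalRing.maximalIdeal A = ⊥ := by rw [← hg]; simp
    exact (IsLocalRing.isField_iff_maximalIdeal_eq.mpr h0).isDomain
  | succ d ih =>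
    intro A _ _ _ g hg hd
    classical
    set m := IsLocalRing.maximalIdeal A with hm
    have hpos : ¬ ringKrullDim A ≤ 0 := by
      intro h
      have := hd.trans h
      have h2 : ((d + 1 : ℕ) : WithBot ℕ∞) ≤ ((0:ℕ) : WithBot ℕ∞) := by simpa using this
      rw [Nat.cast_le] at h2
      omega
    have hnotmin : ∀ p ∈ minimalPrimes A, ¬ m ≤ p := by
      intro p hp hle
      apply hpos
      have hpp : p.IsPrime := hp.1.1
      have hpm : p = m := le_antisymm (IsLocalRing.le_maximalIdeal hpp.ne_top) hle
      rw [← IsLocalRing.maximalIdeal_height_eq_ringKrullDim]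
      have : (IsLocalRing.maximalIdeal A).height = 0 := by
        rw [Ideal.height_eq_zero_iff, ← hm, ← hpm]
        exact hp
      rw [this]; rfl
    have hnotsq : ¬ m ≤ m ^ 2 := by
      intro hle
      have : m = ⊥ := by
        apply Submodule.eq_bot_of_le_smul_of_le_jacobson_bot m m (IsNoetherian.noetherian m)
        · simpa [pow_two] using hle
        · rw [IsLocalRing.jacobson_eq_maximalIdeal ⊥ bot_ne_top]
      obtain ⟨p, hp⟩ := (⊥ : Ideal A).nonempty_minimalPrimes bot_ne_top
      exact hnotmin p hp (this ▸ bot_le)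
    obtain ⟨x, hxm, hxsq, hxmin⟩ : ∃ x ∈ m, x ∉ m ^ 2 ∧ ∀ p ∈ minimalPrimes A, x ∉ p := by
      by_contra hcon
      push Not at hcon
      have hfin : (insert (m ^ 2) (minimalPrimes A)).Finite :=
        (minimalPrimes.finite_of_isNoetherianRing A).insert _
      have := (Ideal.subset_union_prime_finite hfin (f := id) (m ^ 2) (m ^ 2)
        (fun i hi h1 _ => by
          rcases hi with hi | hi
          · exact absurd hi h1
          · exact hi.1.1) (I := m)).1 (by
          intro x hx
          simp only [Set.mem_iUnion]
          by_cases h : x ∈ m ^ 2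
          · exact ⟨m ^ 2, Set.mem_insert _ _, h⟩
          · obtain ⟨p, hp, hxp⟩ := hcon x hx h
            exact ⟨p, Set.mem_insert_of_mem _ hp, hxp⟩)
      obtain ⟨i, hi, hle⟩ := this
      rcases hi with hi | hi
      · exact hnotsq (hi ▸ hle)
      · exact hnotmin i hi hle
    obtain ⟨c, hc⟩ : ∃ c : Fin (d+1) → A, ∑ i, c i * g i = x := by
      have : x ∈ Ideal.span (Set.range g) := hg ▸ hxm
      simpa using (Ideal.mem_span_range_iff_exists_fun).1 this
    have hgm : ∀ i, g i ∈ m := fun i => hg ▸ Ideal.subset_span ⟨i, rfl⟩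
    obtain ⟨i, hi⟩ : ∃ i, IsUnit (c i) := by
      by_contra hcon
      push Not at hcon
      apply hxsq
      rw [← hc, pow_two]
      exact Ideal.sum_mem _ fun i _ => Ideal.mul_mem_mul ((IsLocalRing.mem_maximalIdeal _).2 (hcon i)) (hgm i)
    set I := Ideal.span {x} with hI
    have hIm : I ≤ m := (Ideal.span_singleton_le_iff_mem _).2 hxm
    have hItop : I ≠ ⊤ := fun h => (IsLocalRing.maximalIdeal.isMaximal A).ne_top (top_le_iff.1 (h ▸ hIm))
    have : Nontrivial (A ⧸ I) := Ideal.Quotient.nontrivial_iff.2 hItop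
    have : IsLocalRing (A ⧸ I) := IsLocalRing.of_surjective' _ Ideal.Quotient.mk_surjective
    have hmap : (IsLocalRing.maximalIdeal (A ⧸ I)) = m.map (Ideal.Quotient.mk I) := by
      have := IsLocalHom.of_surjective (Ideal.Quotient.mk I) Ideal.Quotient.mk_surjective
      have this : Ideal.comap (Ideal.Quotient.mk I) (IsLocalRing.maximalIdeal (A ⧸ I)) = IsLocalRing.maximalIdeal A :=
        IsLocalRing.maximalIdeal_comap (Ideal.Quotient.mk I)
      rw [hm, ← this, Ideal.map_comap_of_surjective _ Ideal.Quotient.mk_surjective]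
    have hdom : IsDomain (A ⧸ I) := by
      apply ih (A ⧸ I) (fun j => Ideal.Quotient.mk I (g (i.succAbove j)))
      · rw [hmap, ← hg, Ideal.map_span]
        apply le_antisymm
        · apply Ideal.span_mono
          rintro _ ⟨j, rfl⟩
          exact ⟨_, ⟨_, rfl⟩, rfl⟩
        · rw [Ideal.span_le]
          rintro _ ⟨_, ⟨j, rfl⟩, rfl⟩
          rcases Fin.eq_self_or_eq_succAbove i j with h | ⟨k, h⟩
          · subst h
            obtain ⟨u, hu⟩ := hi
            have h1 : Ideal.Quotient.mk I (g j) =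
                - Ideal.Quotient.mk I (↑u⁻¹) * ∑ k, Ideal.Quotient.mk I (c (j.succAbove k)) *
                  Ideal.Quotient.mk I (g (j.succAbove k)) := by
              have h2 : Ideal.Quotient.mk I x = 0 :=
                Ideal.Quotient.eq_zero_iff_mem.2 (Ideal.mem_span_singleton_self x)
              rw [← hc, Fin.sum_univ_succAbove _ j, map_add, map_sum, map_mul, ← hu] at h2
              simp only [map_mul] at h2
              have h3 : Ideal.Quotient.mk I (↑u⁻¹) * Ideal.Quotient.mk I (↑u) = 1 := by
                rw [← map_mul]; simp
              linear_combination (Ideal.Quotient.mk I (↑u⁻¹)) * h2 - Ideal.Quotient.mk I (g j) * h3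
            rw [h1]
            apply Ideal.mul_mem_left
            exact Ideal.sum_mem _ fun k _ => Ideal.mul_mem_left _ _ (Ideal.subset_span ⟨k, rfl⟩)
          · rw [h]; exact Ideal.subset_span ⟨k, rfl⟩
      · have h1 := ringKrullDim_le_ringKrullDim_quotient_add_encard ({x} : Set A) (by
          rw [IsLocalRing.ringJacobson_eq_maximalIdeal, Set.singleton_subset_iff]; exact hxm)
        have h2 := hd.trans h1
        rw [Nat.cast_add, Nat.cast_one, Set.encard_singleton] at h2
        exact ENat.WithBot.add_le_add_one_right_iff.1 h2
    have hIp : I.IsPrime := (Ideal.Quotient.isDomain_iff_prime I).1 hdom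
    obtain ⟨P, hP, hPI⟩ := Ideal.exists_minimalPrimes_le (I := (⊥ : Ideal A)) (J := I) bot_le
    have hPp : P.IsPrime := hP.1.1
    have hPbot : P = ⊥ := by
      apply Submodule.eq_bot_of_le_smul_of_le_jacobson_bot m P (IsNoetherian.noetherian P)
      · intro p hp
        obtain ⟨r, rfl⟩ := Ideal.mem_span_singleton.1 (hPI hp)
        have hr := (hPp.mem_or_mem hp).resolve_left (hxmin P hP)
        exact Submodule.smul_mem_smul hxm hr
      · rw [IsLocalRing.jacobson_eq_maximalIdeal ⊥ bot_ne_top]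
    subst hPbot
    have := IsDomain.of_bot_isPrime A
    infer_instance

theorem LIC.IsRegularLocalRing.dom {A : Type*} [CommRing A] (h : LIC.IsRegularLocalRing A) :
    IsDomain A := by
  obtain ⟨h1, h2, s, hs, hc⟩ := h
  refine reg_dom s.card A (fun i => (s.equivFin.symm i : A)) ?_ hc.le
  rw [← hs]
  congr 1
  ext x
  constructor
  · rintro ⟨i, rfl⟩; simp
  · intro hx; exact ⟨s.equivFin ⟨x, hx⟩, by simp⟩

end

section
section
variable {B R : Type*} [CommRing B] [CommRing R] (φ : B →+* R) (hφ : Function.Surjective φ)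
  (J : Ideal B) (I : Ideal R) (h : J.map φ = I)

noncomputable def complMapAux (h : J.map φ = I) (n : ℕ) : AdicCompletion J B →+* R ⧸ I ^ n :=
  (Ideal.quotientMap (I ^ n) φ (by
      rw [← Ideal.map_le_iff_le_comap, Ideal.map_pow, h])).comp
        (AdicCompletion.evalₐ J n : AdicCompletion J B →+* B ⧸ J ^ n)

theorem complMapAux_compat (h : J.map φ = I) {m n : ℕ} (hle : m ≤ n) :
    (Ideal.Quotient.factorPow I hle).comp (complMapAux φ J I h n) = complMapAux φ J I h m := by
  ext x
  obtain ⟨x, rfl⟩ := AdicCompletion.mk_surjective _ _ x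
  simp only [complMapAux, RingHom.comp_apply, RingHom.coe_coe, AdicCompletion.evalₐ_mk, Ideal.quotientMap_mk]
  have := AdicCompletion.Ideal.mk_eq_mk J hle x
  rw [Ideal.Quotient.eq] at this
  refine (Ideal.Quotient.factor_mk _ _).trans ?_
  refine Ideal.Quotient.eq.2 ?_
  rw [← map_sub]
  have h3 : (J ^ m).map φ ≤ I ^ m := by rw [Ideal.map_pow, h]
  exact h3 (Ideal.mem_map_of_mem _ this)

noncomputable def complMap (h : J.map φ = I) : AdicCompletion J B →+* AdicCompletion I R :=
  AdicCompletion.liftRingHom I (complMapAux φ J I h) (complMapAux_compat φ J I h)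

theorem complMap_surj (hφ : Function.Surjective φ) (h : J.map φ = I) : Function.Surjective (complMap φ J I h) := by
  intro y
  obtain ⟨y, rfl⟩ := AdicCompletion.mk_surjective _ _ y
  have hy : ∀ n, ∃ j ∈ J ^ n, φ j = y (n+1) - y n := by
    intro n
    have := AdicCompletion.Ideal.mk_eq_mk I (Nat.le_succ n) y
    have h3 : I ^ n ≤ (J ^ n).map φ := by rw [Ideal.map_pow, h]
    exact (Ideal.mem_map_iff_of_surjective _ hφ).1 (h3 (Ideal.Quotient.eq.1 this))
  choose j hj hj2 using hy
  obtain ⟨b, hb⟩ := hφ (y 0)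
  let f : ℕ → B := fun n => b + ∑ i ∈ Finset.range n, j i
  have hf : ∀ n, φ (f n) = y n := by
    intro n
    induction n with
    | zero => simp [f, hb]
    | succ n ih =>
      have : f (n+1) = f n + j n := by simp [f, Finset.sum_range_succ, add_assoc]
      rw [this, map_add, ih, hj2]; ring
  let F : AdicCompletion.AdicCauchySequence J B := AdicCompletion.AdicCauchySequence.mk J B f (by
    intro n
    have : f (n+1) = f n + j n := by simp [f, Finset.sum_range_succ, add_assoc]
    rw [this, SModEq.sub_mem]
    simpa using hj n)
  refine ⟨AdicCompletion.mk J B F, ?_⟩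
  apply AdicCompletion.ext_evalₐ
  intro n
  refine (AdicCompletion.evalₐ_liftRingHom I _ (complMapAux_compat φ J I h) n _).trans ?_
  simp only [complMapAux, RingHom.comp_apply, RingHom.coe_coe, AdicCompletion.evalₐ_mk, Ideal.quotientMap_mk]
  congr 1
  exact hf n
end

theorem noeth_compl {R : Type*} [CommRing R] [IsNoetherianRing R] (I : Ideal R) :
    IsNoetherianRing (AdicCompletion I R) := by
  obtain ⟨n, g, hg⟩ := Submodule.fg_iff_exists_fin_generating_family.1 (IsNoetherian.noetherian I)
  let φ : MvPolynomial (Fin n) R →+* R := (MvPolynomial.aeval g : MvPolynomial (Fin n) R →ₐ[R] R)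
  have hφ : Function.Surjective φ := fun r => ⟨MvPolynomial.C r, by simp [φ]⟩
  have hJ : (MvPolynomial.idealOfVars (Fin n) R).map φ = I := by
    rw [MvPolynomial.idealOfVars, Ideal.map_span, ← hg]
    congr 1
    ext x
    simp [φ]
  have : IsNoetherianRing (AdicCompletion (MvPolynomial.idealOfVars (Fin n) R) (MvPolynomial (Fin n) R)) :=
    isNoetherianRing_of_ringEquiv _ (MvPowerSeries.toAdicCompletionAlgEquiv (Fin n) R).toRingEquiv
  exact isNoetherianRing_of_surjective _ _ (complMap φ _ I hJ) (complMap_surj φ _ I hφ hJ)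

end

section
theorem mem_of_forall_sup_pow {S : Type*} [CommRing S] [IsLocalRing S] [IsNoetherianRing S] (J : Ideal S) (x : S)
    (h : ∀ n, x ∈ J ⊔ IsLocalRing.maximalIdeal S ^ n) : x ∈ J := by
  have := (inferInstance : IsHausdorff (IsLocalRing.maximalIdeal S) (S ⧸ J)).haus (Ideal.Quotient.mk J x) (by
    intro n
    rw [SModEq.zero]
    obtain ⟨j, hj, y, hy, rfl⟩ := Submodule.mem_sup.1 (h n)
    have h1 : Ideal.Quotient.mk J (j + y) = y • (1 : S ⧸ J) := by
      rw [map_add, Ideal.Quotient.eq_zero_iff_mem.2 hj, zero_add, Algebra.smul_def, mul_one]; rfl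
    rw [h1]
    exact Submodule.smul_mem_smul hy trivial)
  exact Ideal.Quotient.eq_zero_iff_mem.1 this

end

section
open Polynomial

theorem krull_between {S : Type*} [CommRing S] [IsNoetherianRing S] (q P N : Ideal S)
    (hq : q.IsPrime) (hP : P.IsPrime) (hN : N.IsPrime) (x : S)
    (hmin : N ∈ (q ⊔ Ideal.span {x}).minimalPrimes) (h1 : q < P) (h2 : P < N) : False := by
  have hh := Ideal.map_height_le_one_of_mem_minimalPrimes hmin
  have hsurj : Function.Surjective (Ideal.Quotient.mk q) := Ideal.Quotient.mk_surjective
  have hPm : (P.map (Ideal.Quotient.mk q)).IsPrime :=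
    Ideal.map_isPrime_of_surjective hsurj (by rw [Ideal.mk_ker]; exact h1.le)
  have hNm : (N.map (Ideal.Quotient.mk q)).IsPrime :=
    Ideal.map_isPrime_of_surjective hsurj (by rw [Ideal.mk_ker]; exact (h1.trans h2).le)
  have key : ∀ I : Ideal S, q ≤ I → (I.map (Ideal.Quotient.mk q)).comap (Ideal.Quotient.mk q) = I := by
    intro I hI
    rw [Ideal.comap_map_of_surjective _ hsurj, ← RingHom.ker_eq_comap_bot, Ideal.mk_ker, sup_eq_left.2 hI]
  have hlt : P.map (Ideal.Quotient.mk q) < N.map (Ideal.Quotient.mk q) := by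
    refine lt_of_le_of_ne (Ideal.map_mono h2.le) fun h => h2.ne ?_
    rw [← key P h1.le, h, key N (h1.trans h2).le]
  have hh2 := (Ideal.height_le_iff (n := 1)).1 (by exact_mod_cast hh) _ hPm hlt
  have h0 : (P.map (Ideal.Quotient.mk q)).height = 0 := by
    have : (P.map (Ideal.Quotient.mk q)).height < 1 := by exact_mod_cast hh2
    exact ENat.lt_one_iff_eq_zero.1 this
  rw [Ideal.height_eq_zero_iff_eq_bot] at h0
  apply h1.ne
  rw [← key P h1.le, h0, ← RingHom.ker_eq_comap_bot, Ideal.mk_ker]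

theorem cat_contra {B : Type*} [CommRing B] [IsDomain B] [IsNoetherianRing B]
    (hcat : LIC.IsCatenaryRing B) (z q N : PrimeSpectrum B) (hz : z.asIdeal = ⊥)
    (h1 : z ⋖ q) (h2 : q ⋖ N) : N.asIdeal.height ≤ 2 := by
  obtain ⟨l, hl, hlen⟩ := Ideal.exists_ltSeries_length_eq_height N.asIdeal
  have hl' : l.last = N := hl
  rw [PrimeSpectrum.height_eq_orderHeight] at hlen ⊢
  have hidx : ∀ i, Order.height (l i) = i := by
    intro i
    apply Order.height_eq_index_of_length_eq_height_last
    rw [hl', hlen]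
  have hzle : ∀ p : PrimeSpectrum B, z ≤ p := fun p => by
    rw [← PrimeSpectrum.asIdeal_le_asIdeal, hz]; exact bot_le
  have hhead : l.head = z := by
    have h0 := hidx 0
    simp only [Fin.val_zero, Nat.cast_zero, Order.height_eq_zero] at h0
    exact le_antisymm (h0 (hzle _)) (hzle _)
  let c : LTSeries (PrimeSpectrum B) := ⟨2, ![z, q, N], by
    intro i; fin_cases i
    · exact h1.lt
    · exact h2.lt⟩
  have hcl : 2 = l.length := hcat c l (by rw [hhead]; rfl) (by rw [hl']; rfl) (by
    intro i; fin_cases i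
    · exact h1
    · exact h2) (by
    intro i
    refine ⟨l.step i, fun x hx1 hx2 => ?_⟩
    have a1 := Order.height_add_one_le hx1
    have a2 := Order.height_add_one_le hx2
    rw [hidx] at a1 a2
    have a3 : ((i : ℕ) : ℕ∞) + 1 + 1 ≤ ((i : ℕ) + 1 : ℕ) := (add_le_add_left a1 1).trans (by simpa using a2)
    have : (((i : ℕ) + 1 + 1 : ℕ) : ℕ∞) ≤ ((i : ℕ) + 1 : ℕ) := by push_cast at a3 ⊢; exact a3
    rw [Nat.cast_le] at this
    omega)
  rw [← hlen, ← hcl]; rfl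

theorem poly_contra {A : Type*} [CommRing A] [IsDomain A] [IsLocalRing A] [IsNoetherianRing A]
    (hcat : LIC.IsCatenaryRing A[X]) (p1 : Ideal A) (hp1 : p1.IsPrime) (hp0 : ⊥ < p1)
    (hpm : p1 < IsLocalRing.maximalIdeal A)
    (𝔮 : Ideal A[X]) (h𝔮 : 𝔮.IsPrime) (hcomap : 𝔮.comap C = ⊥) (w α : A) (hw : w ≠ 0)
    (hwα : C w * X - C α ∈ 𝔮) (h0 : ∀ f ∈ 𝔮, f.coeff 0 ∈ IsLocalRing.maximalIdeal A)
    (M : ℕ) (hM : ∀ c ∈ IsLocalRing.maximalIdeal A ^ M, ∃ d, C c - C d * X ∈ 𝔮) : False := by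
  set m := IsLocalRing.maximalIdeal A with hm
  set N : Ideal A[X] := m.comap constantCoeff with hN
  have hNp : N.IsPrime := Ideal.IsPrime.comap _
  have hXN : X ∈ N := by simp [hN, Ideal.mem_comap]
  have hCN : ∀ c, C c ∈ N ↔ c ∈ m := by intro c; simp [hN, Ideal.mem_comap]
  have hqN : 𝔮 < N := by
    refine lt_of_le_of_ne (fun f hf => ?_) ?_
    · simpa [hN, Ideal.mem_comap] using h0 f hf
    · intro h
      obtain ⟨c, hc, hc0⟩ := Submodule.exists_mem_ne_zero_of_ne_bot (hp0.trans hpm).ne'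
      have : c ∈ 𝔮.comap C := by rw [Ideal.mem_comap, h]; exact (hCN c).2 hc
      rw [hcomap] at this
      exact hc0 this
  have hwq : ∀ a, C a ∈ 𝔮 → a = 0 := by
    intro a ha
    have : a ∈ 𝔮.comap C := ha
    rwa [hcomap] at this
  have hbq : (⊥ : Ideal A[X]) < 𝔮 := by
    refine lt_of_le_of_ne bot_le fun h => ?_
    rw [← h] at hwα
    have := congrArg (fun f => f.coeff 1) ((Ideal.mem_bot).1 hwα)
    simp at this
    exact hw this
  have hmin1 : 𝔮 ∈ ((⊥ : Ideal A[X]) ⊔ Ideal.span {C w * X - C α}).minimalPrimes := by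
    refine ⟨⟨h𝔮, by simpa [Ideal.span_singleton_le_iff_mem] using hwα⟩, ?_⟩
    rintro P ⟨hP, hPs⟩ hPq f hf
    have hmem : C w * X - C α ∈ P := hPs (Ideal.mem_sup_right (Ideal.mem_span_singleton_self _))
    have hpd : ∀ f : A[X], ∃ n : ℕ, ∃ r : A, C (w ^ n) * f - C r ∈ P := by
      intro f
      induction f using Polynomial.induction_on' with
      | add f g hf hg =>
        obtain ⟨n, r, hr⟩ := hf
        obtain ⟨k, s, hs⟩ := hg
        refine ⟨n + k, w ^ k * r + w ^ n * s, ?_⟩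
        have : C (w ^ (n+k)) * (f + g) - C (w ^ k * r + w ^ n * s) =
          C (w ^ k) * (C (w ^ n) * f - C r) + C (w ^ n) * (C (w ^ k) * g - C s) := by
          simp only [pow_add, C_mul, C_add]; ring
        rw [this]
        exact P.add_mem (P.mul_mem_left _ hr) (P.mul_mem_left _ hs)
      | monomial k a =>
        refine ⟨k, a * α ^ k, ?_⟩
        have : C (w ^ k) * monomial k a - C (a * α ^ k) = C a * ((C w * X) ^ k - (C α) ^ k) := by
          rw [← C_mul_X_pow_eq_monomial]; simp only [C_mul, C_pow]; ring
        rw [this]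
        exact P.mul_mem_left _ (P.mem_of_dvd (sub_dvd_pow_sub_pow _ _ k) hmem)
    obtain ⟨n, r, hr⟩ := hpd f
    have hr0 : r = 0 := by
      apply hwq
      have : C r = C (w ^ n) * f - (C (w ^ n) * f - C r) := by ring
      rw [this]
      exact 𝔮.sub_mem (𝔮.mul_mem_left _ hf) (hPq hr)
    rw [hr0, C_0, sub_zero] at hr
    refine (hP.mem_or_mem hr).resolve_left fun h => ?_
    rw [C_pow] at h
    exact hw (hwq w (hPq (hP.mem_of_pow_mem n h)))
  have hmin2 : N ∈ (𝔮 ⊔ Ideal.span {X}).minimalPrimes := by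
    refine ⟨⟨hNp, sup_le hqN.le (by simpa [Ideal.span_singleton_le_iff_mem] using hXN)⟩, ?_⟩
    rintro P ⟨hP, hPs⟩ hPN f hf
    have hX : X ∈ P := hPs (Ideal.mem_sup_right (Ideal.mem_span_singleton_self _))
    have hC : ∀ c ∈ m, C c ∈ P := by
      intro c hc
      obtain ⟨d, hd⟩ := hM (c ^ M) (Ideal.pow_mem_pow hc M)
      apply hP.mem_of_pow_mem M
      have : (C c) ^ M = (C (c ^ M) - C d * X) + C d * X := by rw [C_pow]; ring
      rw [this]
      exact P.add_mem (hPs (Ideal.mem_sup_left hd)) (P.mul_mem_left _ hX)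
    have hf0 : f.coeff 0 ∈ m := by simpa [hN, Ideal.mem_comap] using hf
    rw [← f.divX_mul_X_add]
    exact P.add_mem (P.mul_mem_left _ hX) (hC _ hf0)
  have hbp : (⊥ : Ideal A[X]).IsPrime := Ideal.isPrime_bot
  have hcov := cat_contra hcat ⟨⊥, hbp⟩ ⟨𝔮, h𝔮⟩ ⟨N, hNp⟩ rfl
    ⟨hbq, fun P h1 h2 => krull_between ⊥ P.asIdeal 𝔮 hbp P.2 h𝔮 _ hmin1 h1 h2⟩
    ⟨hqN, fun P h1 h2 => krull_between 𝔮 P.asIdeal N h𝔮 P.2 hNp _ hmin2 h1 h2⟩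
  have hP1 : (p1.map C).IsPrime := Ideal.isPrime_map_C_of_isPrime
  have hPm : (m.map C).IsPrime := Ideal.isPrime_map_C_of_isPrime
  have cm : ∀ (I : Ideal A) c, C c ∈ I.map C ↔ c ∈ I := by
    intro I c
    rw [Ideal.mem_map_C_iff]
    refine ⟨fun h => by simpa using h 0, fun h n => ?_⟩
    rw [coeff_C]; split_ifs; exacts [h, I.zero_mem]
  have c1 : (⊥ : Ideal A[X]) < p1.map C := by
    obtain ⟨c, hc, hc0⟩ := Submodule.exists_mem_ne_zero_of_ne_bot hp0.ne'
    refine lt_of_le_of_ne bot_le fun h => hc0 ?_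
    have := (cm p1 c).2 hc
    rw [← h] at this
    simpa using this
  have c2 : p1.map C < m.map C := by
    obtain ⟨c, hc, hc0⟩ := SetLike.exists_of_lt hpm
    refine lt_of_le_of_ne (Ideal.map_mono hpm.le) fun h => hc0 ?_
    rw [← cm p1, h, cm]; exact hc
  have c3 : m.map C < N := by
    refine lt_of_le_of_ne (Ideal.map_le_iff_le_comap.2 fun c hc => (hCN c).2 hc) fun h => ?_
    rw [← h, Ideal.mem_map_C_iff] at hXN
    have := hXN 1
    rw [coeff_X_one] at this
    exact (IsLocalRing.maximalIdeal.isMaximal A).ne_top ((Ideal.eq_top_iff_one _).2 this)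
  have e1 := Ideal.height_add_one_le_of_lt_of_isPrime c1
  have e2 := Ideal.height_add_one_le_of_lt_of_isPrime c2
  have e3 := Ideal.height_add_one_le_of_lt_of_isPrime c3
  have : (0 : ℕ∞) + 1 + 1 + 1 ≤ 2 := by
    refine le_trans ?_ hcov
    refine le_trans ?_ e3
    gcongr
    refine le_trans ?_ e2
    gcongr
    refine le_trans ?_ e1
    gcongr
    exact zero_le
  have h32 : ((3 : ℕ) : ℕ∞) ≤ ((2 : ℕ) : ℕ∞) := by
    refine le_trans (le_of_eq ?_) this
    norm_num
  rw [Nat.cast_le] at h32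
  omega

end

section
open Polynomial

theorem flat_nzd {A C : Type*} [CommRing A] [CommRing C] [Algebra A C] [Module.Flat A C]
    (b : A) (hb : b ∈ nonZeroDivisors A) (c : C) (h : algebraMap A C b * c = 0) : c = 0 := by
  apply (Module.Flat.isSMulRegular_of_nonZeroDivisors (M := C) hb)
  simpa [Algebra.smul_def] using h

theorem flat_dense_lift {A C : Type*} [CommRing A] [CommRing C] [Algebra A C] [Module.Flat A C]
    (I : Ideal A) (hI : I.FG)
    (hdense : ∀ c : C, ∃ a : A, c - algebraMap A C a ∈ I.map (algebraMap A C))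
    (β : A) (w : C) (hw : ∀ g ∈ I, ∃ x, algebraMap A C g * w = algebraMap A C β * x) :
    ∃ w' : A, (∃ x, w - algebraMap A C w' = algebraMap A C β * x) ∧
      ∀ g ∈ I, ∃ d, g * w' = β * d := by
  obtain ⟨l, g, hg⟩ := Submodule.fg_iff_exists_fin_generating_family.1 hI
  have hgI : ∀ i, g i ∈ I := fun i => hg ▸ Submodule.subset_span ⟨i, rfl⟩
  choose x hx using fun i => hw (g i) (hgI i)
  let f : (Fin l → A) →ₗ[A] (A × (Fin l → A)) :=
    LinearMap.prod (Fintype.linearCombination A g) ((-β) • LinearMap.id)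
  let ξ : (A × (Fin l → A)) →ₗ[A] C :=
    LinearMap.coprod (LinearMap.toSpanSingleton A C w) (Fintype.linearCombination A x)
  have hXf : ξ ∘ₗ f = 0 := by
    apply LinearMap.pi_ext'
    intro i
    ext
    simp [ξ, f, Fintype.linearCombination_apply_single]
    rw [Algebra.smul_def, Algebra.smul_def, ← hx i]; ring
  obtain ⟨k, a, y, hy, haf⟩ := Module.Flat.exists_factorization_of_comp_eq_zero_of_free hXf
  let u : Fin k → A := fun j => a (1, 0) j
  have hu : ∀ i j, g i * u j = β * a (0, Pi.single i 1) j := by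
    intro i j
    have h1 : a (f (Pi.single i 1)) = 0 := LinearMap.congr_fun haf _
    have h2 : f (Pi.single i 1) = g i • ((1 : A), (0 : Fin l → A)) - β • ((0 : A), (Pi.single i 1 : Fin l → A)) := by
      ext <;> simp [f, Fintype.linearCombination_apply_single]
    rw [h2, map_sub, map_smul, map_smul] at h1
    have h3 := DFunLike.congr_fun h1 j
    simp at h3
    exact sub_eq_zero.1 h3
  have hwy : w = ∑ j, algebraMap A C (u j) * y (Finsupp.single j 1) := by
    have h1 : ξ (1, 0) = y (a (1, 0)) := by rw [hy]; rfl
    have h2 : ξ (1, 0) = w := by simp [ξ]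
    rw [← h2, h1, ← Finsupp.univ_sum_single (a (1, 0)), map_sum]
    refine Finset.sum_congr rfl fun j _ => ?_
    have : Finsupp.single j (a (1, 0) j) = u j • Finsupp.single j (1 : A) := by simp [u]
    rw [this, map_smul, Algebra.smul_def]
  have hIu : ∀ c ∈ I, ∀ j, ∃ d, c * u j = β * d := by
    intro c hc j
    rw [← hg] at hc
    induction hc using Submodule.span_induction with
    | mem c hc => obtain ⟨i, rfl⟩ := hc; exact ⟨_, hu i j⟩
    | zero => exact ⟨0, by simp⟩
    | add c c' _ _ h1 h2 =>
      obtain ⟨d, hd⟩ := h1; obtain ⟨d', hd'⟩ := h2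
      exact ⟨d + d', by rw [add_mul, hd, hd', mul_add]⟩
    | smul r c _ h1 =>
      obtain ⟨d, hd⟩ := h1
      exact ⟨r * d, by rw [smul_eq_mul, mul_assoc, hd]; ring⟩
  have hIuC : ∀ c ∈ I.map (algebraMap A C), ∀ j, ∃ d, algebraMap A C (u j) * c = algebraMap A C β * d := by
    intro c hc j
    induction hc using Submodule.span_induction with
    | mem c hc =>
      obtain ⟨i, hi, rfl⟩ := hc
      obtain ⟨d, hd⟩ := hIu i hi j
      exact ⟨algebraMap A C d, by rw [← map_mul, ← map_mul, ← hd, mul_comm]⟩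
    | zero => exact ⟨0, by simp⟩
    | add c c' _ _ h1 h2 =>
      obtain ⟨d, hd⟩ := h1; obtain ⟨d', hd'⟩ := h2
      exact ⟨d + d', by rw [mul_add, hd, hd', mul_add]⟩
    | smul r c _ h1 =>
      obtain ⟨d, hd⟩ := h1
      exact ⟨r * d, by rw [smul_eq_mul, mul_left_comm, hd]; ring⟩
  choose e he using fun j => hdense (y (Finsupp.single j 1))
  refine ⟨∑ j, u j * e j, ?_, ?_⟩
  · choose d hd using fun j => hIuC _ (he j) j
    refine ⟨∑ j, d j, ?_⟩
    rw [hwy, map_sum, ← Finset.sum_sub_distrib, Finset.mul_sum]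
    refine Finset.sum_congr rfl fun j _ => ?_
    rw [← hd, map_mul]; ring
  · intro c hc
    choose d hd using fun j => hIu c hc j
    refine ⟨∑ j, d j * e j, ?_⟩
    rw [Finset.mul_sum, Finset.mul_sum]
    refine Finset.sum_congr rfl fun j _ => ?_
    rw [← mul_assoc, hd]; ring

theorem L4_main {A C : Type*} [CommRing A] [IsDomain A] [IsLocalRing A] [IsNoetherianRing A]
    [CommRing C] [IsLocalRing C] [IsNoetherianRing C] [Algebra A C] [Module.Flat A C]
    (hcat : LIC.IsCatenaryRing A[X]) (p1 : Ideal A) (hp1 : p1.IsPrime) (hp0 : ⊥ < p1)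
    (hpm : p1 < IsLocalRing.maximalIdeal A)
    (hmax : IsLocalRing.maximalIdeal C = (IsLocalRing.maximalIdeal A).map (algebraMap A C))
    (hdense : ∀ (k : ℕ) (c : C), ∃ a : A, c - algebraMap A C a ∈ IsLocalRing.maximalIdeal C ^ k)
    (Q : Ideal C) (hQ : Q.IsPrime) (y : C) (hy : y ∉ Q) (hyQ : ∀ q ∈ Q, q * y = 0)
    (hprimes : ∀ P : Ideal C, P.IsPrime → Q ≤ P → P = Q ∨ P = IsLocalRing.maximalIdeal C) :
    False := by
  set n := IsLocalRing.maximalIdeal C with hn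
  set m := IsLocalRing.maximalIdeal A with hm
  set i := algebraMap A C with hi
  obtain ⟨b, hbm, hb0⟩ := Submodule.exists_mem_ne_zero_of_ne_bot (hp0.trans hpm).ne'
  have hy0 : y ≠ 0 := fun h => hy (h ▸ Q.zero_mem)
  have hin : ∀ a ∈ m, i a ∈ n := fun a ha => by rw [hmax]; exact Ideal.mem_map_of_mem _ ha
  have hAQ : ∀ a, i a ∈ Q → a = 0 := by
    intro a ha
    by_contra hne
    exact hy0 (flat_nzd a (mem_nonZeroDivisors_of_ne_zero hne) y (hyQ _ ha))
  have hbQ : i b ∉ Q := fun h => hb0 (hAQ b h)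
  have hrad : ∀ t : C, t ∉ Q → n ≤ (Q ⊔ Ideal.span {t}).radical := by
    intro t ht
    rw [Ideal.radical_eq_sInf]
    refine le_sInf ?_
    rintro P ⟨hP1, hP2⟩
    rcases hprimes P hP2 (le_sup_left.trans hP1) with h | h
    · exact absurd (h ▸ hP1 (Ideal.mem_sup_right (Ideal.mem_span_singleton_self t))) ht
    · exact h.ge
  obtain ⟨N, hN⟩ := hrad y hy (hin b hbm)
  obtain ⟨κ, hκ, ry, hry, hsum⟩ := Submodule.mem_sup.1 hN
  obtain ⟨r, rfl⟩ := Ideal.mem_span_singleton'.1 hry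
  obtain ⟨M, hM⟩ := Ideal.exists_pow_le_of_le_radical_of_fg
    (hrad (i b * y) fun h => (hQ.mem_or_mem h).elim hbQ hy) (IsNoetherian.noetherian _)
  have hkill : ∀ c ∈ n ^ M, ∃ x, c * (r * y) = i (b ^ (N+1)) * x := by
    intro c hc
    obtain ⟨q, hq, t, ht, rfl⟩ := Submodule.mem_sup.1 (hM hc)
    obtain ⟨s, rfl⟩ := Ideal.mem_span_singleton'.1 ht
    refine ⟨s * y, ?_⟩
    rw [map_pow, pow_succ, ← hsum]
    linear_combination r * hyQ q hq - s * i b * hyQ κ hκ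
  have hpow : (m ^ M).map i = n ^ M := by rw [Ideal.map_pow, hmax]
  obtain ⟨w, ⟨ρ, hρ⟩, hw2⟩ := flat_dense_lift (C := C) (m ^ M) (IsNoetherian.noetherian _)
    (by rw [hpow]; exact hdense M) (b ^ (N+1)) (r * y)
    (fun g hg => hkill _ (hpow ▸ Ideal.mem_map_of_mem _ hg))
  have hunit : IsUnit (1 - i b * ρ) :=
    IsLocalRing.isUnit_one_sub_self_of_mem_nonunits _ ((IsLocalRing.mem_maximalIdeal _).1 (n.mul_mem_right _ (hin b hbm)))
  obtain ⟨v, hv⟩ := hunit.exists_left_inv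
  let D := C ⧸ Q
  let π : C →+* D := Ideal.Quotient.mk Q
  have hπ : ∀ c, π c = 0 ↔ c ∈ Q := fun c => Ideal.Quotient.eq_zero_iff_mem
  have hDw : π (i w) = π (i b) ^ N * (1 - π (i b) * π ρ) := by
    have h1 : i w = i b ^ N * (1 - i b * ρ) - κ := by
      rw [map_pow, pow_succ] at hρ
      linear_combination hsum - hρ
    rw [h1, map_sub, (hπ κ).2 hκ]; simp
  have hπv : π v * (1 - π (i b) * π ρ) = 1 := by
    rw [← map_mul, ← map_one π, ← map_sub, ← map_mul, hv]
  have hπb : π (i b) ≠ 0 := fun h => hbQ ((hπ _).1 h)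
  let τ : D := π (i b * v)
  have hτ : τ = π (i b) * π v := map_mul _ _ _
  let ev : A[X] →+* D := eval₂RingHom (π.comp i) τ
  have hevC : ∀ a, ev (Polynomial.C a) = π (i a) := fun a => by simp [ev]
  have hevX : ev X = τ := by simp [ev]
  have hw0 : w ≠ 0 := by
    rintro rfl
    rw [map_zero, map_zero] at hDw
    have h2 : π v * 0 = π (i b) ^ N := by
      rw [hDw]; linear_combination π (i b) ^ N * hπv
    rw [mul_zero] at h2
    exact pow_ne_zero N hπb h2.symm
  refine poly_contra hcat p1 hp1 hp0 hpm (RingHom.ker ev) (RingHom.ker_isPrime ev) ?_ w (b ^ (N+1)) hw0 ?_ ?_ M ?_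
  · rw [eq_bot_iff]
    intro a ha
    rw [Ideal.mem_comap, RingHom.mem_ker, hevC, hπ] at ha
    exact hAQ a ha
  · rw [RingHom.mem_ker, map_sub, map_mul, hevC, hevC, hevX, hDw, hτ, map_pow, map_pow]
    linear_combination π (i b) ^ (N+1) * hπv
  · intro f hf
    by_contra hcon
    have hu : IsUnit (f.coeff 0) := by
      by_contra h; exact hcon ((IsLocalRing.mem_maximalIdeal _).2 h)
    rw [RingHom.mem_ker, ← f.divX_mul_X_add, map_add, map_mul, hevC, hevX] at hf
    obtain ⟨e, he⟩ := Ideal.Quotient.mk_surjective (ev f.divX)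
    have h1 : e * (i b * v) + i (f.coeff 0) ∈ Q := by
      rw [← hπ, map_add, map_mul]
      have : π e = ev f.divX := he
      rw [this]; exact hf
    have h2 : e * (i b * v) ∈ n := n.mul_mem_left _ (n.mul_mem_right _ (hin b hbm))
    have h3 : i (f.coeff 0) ∈ n := by
      have := n.sub_mem (IsLocalRing.le_maximalIdeal hQ.ne_top h1) h2
      simpa using this
    exact (IsLocalRing.mem_maximalIdeal _).1 h3 (hu.map i)
  · intro c hc
    obtain ⟨d, hd⟩ := hw2 c hc
    refine ⟨d, ?_⟩
    rw [RingHom.mem_ker, map_sub, map_mul, hevC, hevC, hevX, hτ]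
    have h1 : π (i c) * π (i w) = π (i b) ^ (N+1) * π (i d) := by
      rw [← map_mul, ← map_mul, hd, map_mul, map_mul, map_pow, map_pow]
    rw [hDw] at h1
    apply mul_left_cancel₀ (pow_ne_zero N hπb)
    linear_combination π v * h1 - π (i b) ^ N * π (i c) * hπv

end

section
section
open scoped TensorProduct

theorem L6_main {R S : Type u} [CommRing R] [CommRing S] [IsNoetherianRing R] [IsNoetherianRing S]
    [Algebra R S] [Module.Flat R S] (Q : Ideal S) (hQ : Q.IsPrime) (z : S)
    (hz : ∀ s, s * z = 0 ↔ s ∈ Q) (p : Ideal R) (hp : p = Q.comap (algebraMap R S)) :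
    ∃ y : (R ⧸ p) ⊗[R] S, ∀ s : S, ((1 : R ⧸ p) ⊗ₜ[R] s) * y = 0 ↔ s ∈ Q := by
  have hmem : ∀ (N : Type u) [AddCommGroup N] [Module R N],
      Q ∈ associatedPrimes S (S ⊗[R] N) ↔ ∃ y : S ⊗[R] N, ∀ s : S, s • y = 0 ↔ s ∈ Q := by
    intro N _ _
    rw [AssociatedPrimes.mem_iff, isAssociatedPrime_iff]
    constructor
    · rintro ⟨_, x, hx⟩
      refine ⟨x, fun s => ?_⟩
      rw [hx, Submodule.mem_colon_singleton, Submodule.mem_bot]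
    · rintro ⟨y, hy⟩
      refine ⟨hQ, y, ?_⟩
      ext s
      rw [← hy, Submodule.mem_colon_singleton, Submodule.mem_bot]
  have key : ∀ (N : Type u) [AddCommGroup N] [Module R N], Module.Finite R N →
      Q ∈ associatedPrimes S (S ⊗[R] N) → Q ∈ associatedPrimes S (S ⊗[R] (R ⧸ p)) := by
    intro N _ _ hfin
    induction hfin using IsNoetherianRing.induction_on_isQuotientEquivQuotientPrime with
    | subsingleton N =>
      intro h
      rw [associatedPrimes.eq_empty_of_subsingleton] at h
      exact h.elim
    | quotient N p' e =>
      intro h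
      rw [LinearEquiv.AssociatedPrimes.eq (e.baseChange R S N _)] at h
      have : p'.1 = p := by
        obtain ⟨y, hy⟩ := (hmem _).1 h
        ext r
        rw [hp, Ideal.mem_comap, ← hy, algebraMap_smul]
        constructor
        · intro hr
          have h1 : r • (LinearMap.id : (R ⧸ p'.1) →ₗ[R] (R ⧸ p'.1)) = 0 := by
            ext
            simp [Algebra.smul_def, Ideal.Quotient.eq_zero_iff_mem.2 hr]
          have h2 := congrArg (LinearMap.lTensor S) h1
          rw [LinearMap.lTensor_smul, LinearMap.lTensor_id, LinearMap.lTensor_zero] at h2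
          exact LinearMap.congr_fun h2 y
        · intro hr
          by_contra hrp
          have hinj : Function.Injective (r • (LinearMap.id : (R ⧸ p'.1) →ₗ[R] (R ⧸ p'.1))) := by
            rw [injective_iff_map_eq_zero]
            intro x hx
            have := p'.2
            simp [Algebra.smul_def] at hx
            exact hx.resolve_left fun h => hrp (Ideal.Quotient.eq_zero_iff_mem.1 h)
          have h2 := Module.Flat.lTensor_preserves_injective_linearMap (M := S) _ hinj
          rw [LinearMap.lTensor_smul, LinearMap.lTensor_id, injective_iff_map_eq_zero] at h2
          have h3 := h2 y hr
          have : (1 : S) ∈ Q := (hy 1).1 (by rw [h3, smul_zero])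
          exact hQ.ne_top ((Ideal.eq_top_iff_one _).2 this)
      rw [← this]; exact h
    | exact N₁ N₂ N₃ f g hf hg hfg h₁ h₃ =>
      intro h
      have hf' : Function.Injective (f.baseChange S) :=
        Module.Flat.lTensor_preserves_injective_linearMap (M := S) _ hf
      have hfg' : Function.Exact (f.baseChange S) (g.baseChange S) :=
        lTensor_exact S hfg hg
      exact (associatedPrimes.subset_union_of_exact hf' hfg' h).elim h₁ h₃
  obtain ⟨y, hy⟩ := (hmem _).1 (key R inferInstance ((hmem R).2 ⟨z ⊗ₜ 1, fun s => by
    rw [← hz, TensorProduct.smul_tmul', smul_eq_mul]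
    constructor
    · intro h
      have := congrArg (TensorProduct.rid R S) h
      simpa using this
    · intro h; rw [h, TensorProduct.zero_tmul]⟩))
  refine ⟨Algebra.TensorProduct.comm R S (R ⧸ p) y, fun s => ?_⟩
  rw [← hy]
  have : (1 : R ⧸ p) ⊗ₜ[R] s = Algebra.TensorProduct.comm R S (R ⧸ p) (s ⊗ₜ 1) := by simp
  rw [this, ← map_mul, EmbeddingLike.map_eq_zero_iff]
  have h2 : ∀ y, (s ⊗ₜ[R] (1 : R ⧸ p)) * y = s • y := by
    intro y
    induction y using TensorProduct.induction_on with
    | zero => simp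
    | tmul a b => rw [Algebra.TensorProduct.tmul_mul_tmul, TensorProduct.smul_tmul', one_mul, smul_eq_mul]
    | add a b ha hb => rw [mul_add, smul_add, ha, hb]
  rw [h2]
end

end

section
section
open scoped TensorProduct

theorem surj_max {S C : Type*} [CommRing S] [CommRing C] [IsLocalRing S] [IsLocalRing C]
    (f : S →+* C) (hf : Function.Surjective f) :
    (IsLocalRing.maximalIdeal S).map f = IsLocalRing.maximalIdeal C := by
  have := IsLocalHom.of_surjective f hf
  apply le_antisymm
  · rw [Ideal.map_le_iff_le_comap]
    intro s hs
    exact map_nonunit f s hs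
  · intro c hc
    obtain ⟨s, rfl⟩ := hf c
    refine Ideal.mem_map_of_mem _ ?_
    by_contra h
    rw [IsLocalRing.mem_maximalIdeal, mem_nonunits_iff, not_not] at h
    exact hc (h.map f)

theorem L3_main {R S : Type u} [CommRing R] [CommRing S] [IsNoetherianRing S]
    [Algebra R S] [Module.Flat R S] (Q : Ideal S) (hQ : Q.IsPrime)
    (p : Ideal R) (hp : p.IsPrime)
    (H3 : LIC.IsRegularRing (FractionRing (R ⧸ p) ⊗[R] S))
    (y0 : (R ⧸ p) ⊗[R] S) (hy0 : ∀ s : S, ((1 : R ⧸ p) ⊗ₜ[R] s) * y0 = 0 ↔ s ∈ Q) :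
    ∃ s : S, s ∉ Q ∧ ∀ q ∈ Q, (1 : R ⧸ p) ⊗ₜ[R] (q * s) = 0 := by
  let A := R ⧸ p
  let K := FractionRing A
  let C := A ⊗[R] S
  let E := K ⊗[R] S
  let i : S →ₐ[R] C := Algebra.TensorProduct.includeRight
  have hi : Function.Surjective i :=
    Algebra.TensorProduct.includeRight_surjective _ Ideal.Quotient.mk_surjective
  let j : C →ₐ[R] E := Algebra.TensorProduct.map (IsScalarTower.toAlgHom R A K) (AlgHom.id R S)
  have hj : Function.Injective j := by
    have h0 : Function.Injective (IsScalarTower.toAlgHom R A K).toLinearMap :=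
      IsFractionRing.injective A K
    exact Module.Flat.rTensor_preserves_injective_linearMap (M := S) _ h0
  have hy1 : ∀ s, i s * y0 = 0 ↔ s ∈ Q := hy0
  have hden : ∀ e : E, ∃ (σ : E) (s : S), IsUnit σ ∧ σ * e = j (i s) := by
    intro e
    suffices h : ∃ (σ : A) (c : C), σ ≠ 0 ∧ (algebraMap A K σ ⊗ₜ[R] (1 : S)) * e = j c by
      obtain ⟨σ, c, h0, h1⟩ := h
      obtain ⟨s, rfl⟩ := hi c
      refine ⟨algebraMap A K σ ⊗ₜ[R] (1 : S), s, ?_, h1⟩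
      have hu : IsUnit (algebraMap A K σ) := by
        rw [isUnit_iff_ne_zero]
        exact fun h => h0 ((IsFractionRing.injective A K) (h.trans (map_zero _).symm))
      exact hu.map (Algebra.TensorProduct.includeLeft : K →ₐ[R] E)
    induction e using TensorProduct.induction_on with
    | zero => exact ⟨1, 0, one_ne_zero, by simp⟩
    | tmul k s =>
      obtain ⟨⟨a, σ⟩, h⟩ := IsLocalization.surj (nonZeroDivisors A) k
      refine ⟨σ, a ⊗ₜ s, nonZeroDivisors.ne_zero σ.2, ?_⟩
      rw [Algebra.TensorProduct.tmul_mul_tmul, one_mul, mul_comm, h]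
      rfl
    | add e e' h h' =>
      obtain ⟨σ, c, h0, h1⟩ := h
      obtain ⟨σ', c', h0', h1'⟩ := h'
      refine ⟨σ * σ', (σ' ⊗ₜ 1) * c + (σ ⊗ₜ 1) * c', mul_ne_zero h0 h0', ?_⟩
      have h2 : ∀ t : A, j (t ⊗ₜ 1) = algebraMap A K t ⊗ₜ[R] (1 : S) := fun t => rfl
      have h3 : algebraMap A K (σ * σ') ⊗ₜ[R] (1 : S) = (algebraMap A K σ ⊗ₜ[R] (1 : S)) * (algebraMap A K σ' ⊗ₜ[R] (1 : S)) := by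
        rw [Algebra.TensorProduct.tmul_mul_tmul, map_mul, one_mul]
      rw [h3, map_add, map_mul j, map_mul j, h2, h2, ← h1, ← h1']
      ring
  let 𝔔 : Ideal E := LinearMap.ker (LinearMap.toSpanSingleton E E (j y0))
  have hmem : ∀ e, e ∈ 𝔔 ↔ e * j y0 = 0 := fun e => Iff.rfl
  have hmem2 : ∀ s, j (i s) ∈ 𝔔 ↔ s ∈ Q := by
    intro s
    rw [hmem, ← map_mul, map_eq_zero_iff j hj, hy1]
  have hmem3 : ∀ (e σ : E) (s : S), IsUnit σ → σ * e = j (i s) → (e ∈ 𝔔 ↔ s ∈ Q) := by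
    intro e σ s hσ h
    rw [← hmem2, ← h, Ideal.unit_mul_mem_iff_mem _ hσ]
  have hprime : 𝔔.IsPrime := by
    constructor
    · rw [Ne, Ideal.eq_top_iff_one, ← map_one j, ← map_one i, hmem2]
      exact fun h => hQ.ne_top ((Ideal.eq_top_iff_one _).2 h)
    · intro e e' hee
      obtain ⟨σ, s, hσ, h⟩ := hden e
      obtain ⟨σ', s', hσ', h'⟩ := hden e'
      rw [hmem3 e σ s hσ h, hmem3 e' σ' s' hσ' h']
      rw [hmem3 (e * e') (σ * σ') (s * s') (hσ.mul hσ') (by rw [map_mul, map_mul, ← h, ← h']; ring)] at hee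
      exact hQ.mem_or_mem hee
  have hdom := LIC.IsRegularLocalRing.dom (H3 𝔔 hprime)
  let loc := algebraMap E (Localization.AtPrime 𝔔)
  have hloc : ∀ e, loc e = 0 → ∃ t, t ∉ 𝔔 ∧ t * e = 0 := by
    intro e he
    obtain ⟨t, ht⟩ := (IsLocalization.map_eq_zero_iff 𝔔.primeCompl _ e).1 he
    exact ⟨t, t.2, ht⟩
  have hone : ∀ q ∈ Q, ∃ s, s ∉ Q ∧ i (q * s) = 0 := by
    intro q hq
    have h1 : loc (j (i q)) * loc (j y0) = 0 := by
      rw [← map_mul, (hmem _).1 ((hmem2 q).2 hq), map_zero]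
    rcases mul_eq_zero.1 h1 with h | h
    · obtain ⟨t, ht, h2⟩ := hloc _ h
      obtain ⟨σ, s, hσ, h3⟩ := hden t
      refine ⟨s, fun hs => ht ((hmem3 t σ s hσ h3).2 hs), hj ?_⟩
      rw [map_zero, map_mul, map_mul, ← h3]
      linear_combination σ * h2
    · obtain ⟨t, ht, h2⟩ := hloc _ h
      exact (ht h2).elim
  classical
  choose! f hf1 hf2 using hone
  obtain ⟨G, hG⟩ := (IsNoetherian.noetherian Q)
  have hGQ : ∀ g ∈ G, g ∈ Q := fun g hg => hG ▸ Submodule.subset_span hg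
  refine ⟨∏ g ∈ G, f g, ?_, ?_⟩
  · rw [hQ.prod_mem_iff]
    rintro ⟨g, hg, h⟩
    exact hf1 g (hGQ g hg) h
  · intro q hq
    change i (q * _) = 0
    rw [← hG] at hq
    induction hq using Submodule.span_induction with
    | mem g hg =>
      rw [← Finset.mul_prod_erase G f hg, ← mul_assoc, map_mul, hf2 g (hGQ g hg), zero_mul]
    | zero => simp
    | add a b _ _ h1 h2 => rw [add_mul, map_add, h1, h2, add_zero]
    | smul r a _ h1 => rw [smul_eq_mul, mul_assoc, map_mul, h1, mul_zero]

theorem L7_main {R S : Type u} [CommRing R] [CommRing S] [IsNoetherianRing R] [IsNoetherianRing S]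
    [IsLocalRing R] [IsLocalRing S] [Algebra R S] [Module.Flat R S]
    (hmax : IsLocalRing.maximalIdeal S = (IsLocalRing.maximalIdeal R).map (algebraMap R S))
    (hdense : ∀ (k : ℕ) (c : S), ∃ a : R, c - algebraMap R S a ∈ IsLocalRing.maximalIdeal S ^ k)
    (H1 : ∀ p : Ideal R, p.IsPrime → (∀ x ∈ p, x ∉ nonZeroDivisors R) →
      ∃ p1 : Ideal R, p1.IsPrime ∧ p < p1 ∧ p1 < IsLocalRing.maximalIdeal R)
    (H2 : ∀ p : Ideal R, p.IsPrime → LIC.IsCatenaryRing (Polynomial (R ⧸ p)))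
    (H3 : ∀ p : Ideal R, ∀ _ : p.IsPrime, LIC.IsRegularRing (FractionRing (R ⧸ p) ⊗[R] S))
    (Q : Ideal S) (hQ : Q.IsPrime) (z : S) (hz : ∀ s, s * z = 0 ↔ s ∈ Q)
    (hno : ∀ P : Ideal S, P.IsPrime → Q ≤ P → P = Q ∨ P = IsLocalRing.maximalIdeal S) : False := by
  set p := Q.comap (algebraMap R S) with hpdef
  have hp : p.IsPrime := Ideal.comap_isPrime _ _
  have hz0 : z ≠ 0 := by
    rintro rfl
    exact hQ.ne_top ((Ideal.eq_top_iff_one _).2 ((hz 1).1 (by simp)))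
  have hpz : ∀ x ∈ p, x ∉ nonZeroDivisors R := fun x hx hx' =>
    hz0 (flat_nzd x hx' z ((hz _).2 hx))
  obtain ⟨p1, hp1, hpp1, hp1m⟩ := H1 p hp hpz
  obtain ⟨y0, hy0⟩ := L6_main Q hQ z hz p hpdef
  obtain ⟨s, hsQ, hs⟩ := L3_main Q hQ p hp (H3 p hp) y0 hy0
  let A := R ⧸ p
  let C := A ⊗[R] S
  let i : S →ₐ[R] C := Algebra.TensorProduct.includeRight
  have hi : Function.Surjective i :=
    Algebra.TensorProduct.includeRight_surjective _ Ideal.Quotient.mk_surjective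
  have hy1 : ∀ s, i s * y0 = 0 ↔ s ∈ Q := hy0
  have hker : RingHom.ker i ≤ Q := by
    intro t ht
    rw [← hy1, (RingHom.mem_ker).1 ht, zero_mul]
  have : Nontrivial C := by
    refine ⟨1, 0, fun h => hsQ ?_⟩
    rw [← hy1, ← one_mul (i s * y0), h, zero_mul]
  have : IsLocalRing C := IsLocalRing.of_surjective' i.toRingHom hi
  have : IsNoetherianRing C := isNoetherianRing_of_surjective S C i.toRingHom hi
  let qm := Ideal.Quotient.mk p
  have hqm : Function.Surjective qm := Ideal.Quotient.mk_surjective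
  have : IsLocalRing A := IsLocalRing.of_surjective' qm hqm
  have : Module.Flat A C := Module.Flat.baseChange R A S
  have hmA : (IsLocalRing.maximalIdeal R).map qm = IsLocalRing.maximalIdeal A := surj_max qm hqm
  have hmC : (IsLocalRing.maximalIdeal S).map i.toRingHom = IsLocalRing.maximalIdeal C := surj_max i.toRingHom hi
  have hcomm : i.toRingHom.comp (algebraMap R S) = (algebraMap A C).comp qm := by
    ext r
    change i (algebraMap R S r) = algebraMap A C (algebraMap R A r)
    rw [AlgHom.commutes, ← IsScalarTower.algebraMap_apply R A C]
  have hcomm' : ∀ r, i (algebraMap R S r) = algebraMap A C (qm r) := fun r => RingHom.congr_fun hcomm r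
  have hmap : ∀ (I : Ideal R) (hI : p ≤ I), (I.map qm).comap qm = I := by
    intro I hI
    rw [Ideal.comap_map_of_surjective _ hqm, ← RingHom.ker_eq_comap_bot, Ideal.mk_ker, sup_eq_left.2 hI]
  have hQc : (Q.map i.toRingHom).comap i.toRingHom = Q := by
    rw [Ideal.comap_map_of_surjective i.toRingHom hi, ← RingHom.ker_eq_comap_bot]
    exact sup_eq_left.2 hker
  refine L4_main (A := A) (C := C) (H2 p hp) (p1.map qm) ?_ ?_ ?_ ?_ ?_ (Q.map i.toRingHom) ?_ (i s) ?_ ?_ ?_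
  · exact Ideal.map_isPrime_of_surjective hqm (by rw [Ideal.mk_ker]; exact hpp1.le)
  · rw [bot_lt_iff_ne_bot]
    intro h
    have := hmap p1 hpp1.le
    rw [h, ← RingHom.ker_eq_comap_bot, Ideal.mk_ker] at this
    exact hpp1.ne this
  · rw [← hmA]
    refine lt_of_le_of_ne (Ideal.map_mono hp1m.le) fun h => ?_
    have h1 := hmap p1 hpp1.le
    rw [h, hmap _ (hpp1.trans hp1m).le] at h1
    exact hp1m.ne h1.symm
  · rw [← hmC, ← hmA, hmax, Ideal.map_map, Ideal.map_map, hcomm]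
  · intro k c
    obtain ⟨t, rfl⟩ := hi c
    obtain ⟨a, ha⟩ := hdense k t
    refine ⟨qm a, ?_⟩
    rw [← hcomm', ← map_sub, ← hmC, ← Ideal.map_pow]
    exact Ideal.mem_map_of_mem i.toRingHom ha
  · exact Ideal.map_isPrime_of_surjective hi hker
  · intro h
    rw [← hQc] at hsQ
    exact hsQ h
  · intro q hq
    obtain ⟨t, rfl⟩ := hi q
    have ht : t ∈ Q := by rw [← hQc]; exact hq
    have := hs t ht
    rw [← map_mul]; exact this
  · intro P hP hQP
    have h1 : Q ≤ P.comap i.toRingHom := by rw [← hQc]; exact Ideal.comap_mono hQP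
    have h2 : (P.comap i.toRingHom).map i.toRingHom = P := Ideal.map_comap_of_surjective _ hi _
    rcases hno _ (Ideal.comap_isPrime _ _) h1 with h | h
    · left; rw [← h2, h]
    · right; rw [← h2, h, hmC]
end

end

section
theorem L8_main {R S : Type*} [CommRing R] [CommRing S] [IsLocalRing R] [IsLocalRing S]
    [IsNoetherianRing S] [Algebra R S]
    (hmax : IsLocalRing.maximalIdeal S = (IsLocalRing.maximalIdeal R).map (algebraMap R S))
    (Q : Ideal S) (hQ : Q.IsPrime) (z : S) (hz : ∀ s, s * z = 0 ↔ s ∈ Q)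
    (P0 : Ideal S) (hP0 : P0.IsPrime) (hQP0 : Q < P0) (hP0m : P0 < IsLocalRing.maximalIdeal S)
    (b : R) (hbm : b ∈ IsLocalRing.maximalIdeal R) (hbQ : algebraMap R S b ∉ Q)
    (hbr : ∀ c : S, algebraMap R S b * c = 0 → c = 0)
    (hab : ∀ a b : R, z * (algebraMap R S a * algebraMap R S b) ∈
      Ideal.span {algebraMap R S a ^ 2, algebraMap R S b ^ 2}) : False := by
  set i := algebraMap R S with hi
  have hin : ∀ a ∈ IsLocalRing.maximalIdeal R, i a ∈ IsLocalRing.maximalIdeal S := fun a ha => by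
    rw [hmax]; exact Ideal.mem_map_of_mem _ ha
  have hle : Q ⊔ Ideal.span {i b} ≤ IsLocalRing.maximalIdeal S :=
    sup_le (hQP0.trans hP0m).le (by rw [Ideal.span_singleton_le_iff_mem]; exact hin b hbm)
  obtain ⟨P, hPmin, hPm⟩ := Ideal.exists_minimalPrimes_le hle
  have hP : P.IsPrime := hPmin.1.1
  have hQP : Q ≤ P := le_sup_left.trans hPmin.1.2
  have hbP : i b ∈ P := hPmin.1.2 (Ideal.mem_sup_right (Ideal.mem_span_singleton_self _))
  have hPne : P ≠ IsLocalRing.maximalIdeal S := by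
    intro h
    exact krull_between Q P0 P hQ hP0 hP (i b) hPmin hQP0 (h ▸ hP0m)
  obtain ⟨a, ham, haP⟩ : ∃ a ∈ IsLocalRing.maximalIdeal R, i a ∉ P := by
    by_contra! hcon
    refine hPne (le_antisymm hPm ?_)
    rw [hmax, Ideal.map_le_iff_le_comap]
    exact hcon
  have hbr' : ∀ (j : ℕ) (c : S), i b ^ j * c = 0 → c = 0 := by
    intro j
    induction j with
    | zero => intro c h; simpa using h
    | succ j ih => intro c h; exact hbr c (ih _ (by rw [← h]; ring))
  have key : ∀ j : ℕ, ∃ (h : ℕ) (x : S), i a ^ h * z = i b ^ j * x := by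
    intro j
    let J : Ideal S := Ideal.span {i b ^ (2 * j)}
    let f : ℕ →o Submodule S S := ⟨fun n => Submodule.comap (LinearMap.mulLeft S (i a ^ n)) J, by
      intro n n' hnn x hx
      obtain ⟨d, rfl⟩ := Nat.exists_eq_add_of_le hnn
      simp only [Submodule.mem_comap, LinearMap.mulLeft_apply] at hx ⊢
      rw [pow_add, mul_comm (i a ^ n), mul_assoc]
      exact J.mul_mem_left _ hx⟩
    obtain ⟨h, hh⟩ := monotone_stabilizes_iff_noetherian.2 (inferInstance : IsNoetherian S S) f
    have h1 : ∀ n, i a ^ h * (z * i b ^ j) ∈ J ⊔ IsLocalRing.maximalIdeal S ^ n := by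
      intro n0
      obtain ⟨n, hn, hnh⟩ : ∃ n, n0 ≤ n ∧ h ≤ n := ⟨max n0 h, le_max_left _ _, le_max_right _ _⟩
      obtain ⟨u, v, huv⟩ := Ideal.mem_span_pair.1 (hab (a ^ n) (b ^ j))
      rw [map_pow, map_pow] at huv
      have h2 : z * i b ^ j - i a ^ n * u ∈ f n := by
        change i a ^ n * (z * i b ^ j - i a ^ n * u) ∈ J
        refine Ideal.mem_span_singleton'.2 ⟨v, ?_⟩
        linear_combination huv
      rw [← hh n hnh] at h2
      have h3 : i a ^ h * (z * i b ^ j - i a ^ n * u) ∈ J := h2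
      have h4 : i a ^ h * (z * i b ^ j) = i a ^ h * (z * i b ^ j - i a ^ n * u) + (i a ^ h * u) * i a ^ n := by ring
      rw [h4]
      refine Ideal.add_mem _ (Ideal.mem_sup_left h3) (Ideal.mem_sup_right ?_)
      exact Ideal.mul_mem_left _ _ (Ideal.pow_le_pow_right hn (Ideal.pow_mem_pow (hin a ham) n))
    obtain ⟨v, hv⟩ := Ideal.mem_span_singleton'.1 (mem_of_forall_sup_pow J _ h1)
    refine ⟨h, v, sub_eq_zero.1 (hbr' j _ ?_)⟩
    linear_combination -hv
  let SP := Localization.AtPrime P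
  let l := algebraMap S SP
  have hlb : l (i b) ∈ IsLocalRing.maximalIdeal SP := by
    rw [← Localization.AtPrime.map_eq_maximalIdeal]
    exact Ideal.mem_map_of_mem _ hbP
  have hla : IsUnit (l (i a)) := IsLocalization.map_units SP (⟨i a, haP⟩ : P.primeCompl)
  have : IsNoetherianRing SP := IsLocalization.isNoetherianRing P.primeCompl SP inferInstance
  have hz0 : l z = 0 := by
    rw [← Ideal.mem_bot]
    refine mem_of_forall_sup_pow _ _ fun j => Ideal.mem_sup_right ?_
    obtain ⟨h, x, hx⟩ := key j
    rw [← Ideal.unit_mul_mem_iff_mem _ (hla.pow h), ← map_pow, ← map_mul, hx, map_mul, map_pow]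
    exact Ideal.mul_mem_right _ _ (Ideal.pow_mem_pow hlb j)
  obtain ⟨t, ht⟩ := (IsLocalization.map_eq_zero_iff P.primeCompl SP z).1 hz0
  exact t.2 (hQP ((hz _).1 ht))

end

section
theorem compl_ker {R : Type*} [CommRing R] (I : Ideal R) (hI : I.FG) (n : ℕ) (x : AdicCompletion I R)
    (h : AdicCompletion.evalₐ I n x = 0) : x ∈ (I.map (algebraMap R (AdicCompletion I R))) ^ n := by
  have h2 : AdicCompletion.eval I R n x = 0 := by
    rw [← AdicCompletion.factor_evalₐ_eq_eval I x (by simp), h, map_zero]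
  rw [← LinearMap.mem_ker, ← AdicCompletion.pow_smul_top_eq_ker_eval hI] at h2
  rw [← Ideal.map_pow]
  refine Submodule.smul_induction_on h2 ?_ ?_
  · intro r hr y _
    rw [Algebra.smul_def]
    exact Ideal.mul_mem_right _ _ (Ideal.mem_map_of_mem _ hr)
  · intro x y hx hy
    exact Ideal.add_mem _ hx hy

end

section
theorem art_pow {R : Type*} [CommRing R] [IsLocalRing R] [IsNoetherianRing R] (j : ℕ) :
    IsArtinianRing (R ⧸ IsLocalRing.maximalIdeal R ^ j) := by
  rcases Nat.eq_zero_or_pos j with rfl | hj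
  · have : Subsingleton (R ⧸ IsLocalRing.maximalIdeal R ^ 0) := by
      rw [Ideal.Quotient.subsingleton_iff]; simp
    infer_instance
  · have hle : IsLocalRing.maximalIdeal R ^ j ≤ IsLocalRing.maximalIdeal R := Ideal.pow_le_self hj.ne'
    have : Nontrivial (R ⧸ IsLocalRing.maximalIdeal R ^ j) := by
      rw [Ideal.Quotient.nontrivial_iff]
      intro h
      rw [h] at hle
      exact (IsLocalRing.maximalIdeal.isMaximal R).ne_top (top_le_iff.1 hle)
    have : IsLocalRing (R ⧸ IsLocalRing.maximalIdeal R ^ j) :=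
      IsLocalRing.of_surjective' (Ideal.Quotient.mk _) Ideal.Quotient.mk_surjective
    rw [isArtinianRing_iff_isNilpotent_maximalIdeal]
    refine ⟨j, ?_⟩
    rw [← surj_max (Ideal.Quotient.mk (IsLocalRing.maximalIdeal R ^ j)) Ideal.Quotient.mk_surjective, ← Ideal.map_pow]
    exact Ideal.map_quotient_self _

theorem chev {R ι : Type*} [CommRing R] [DecidableEq ι] (m : Ideal R) (J : Finset ι → Ideal R)
    (hJ : ∀ T T', T ⊆ T' → J T' ≤ J T) (hart : ∀ j, IsArtinianRing (R ⧸ m ^ j)) (k : ℕ)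
    (hk : ∀ T, ¬ J T ≤ m ^ k) :
    ∃ w : ℕ → R, (∀ n, w (n+1) - w n ∈ m ^ n) ∧ w k ∉ m ^ k ∧ ∀ n T, w n ∈ J T ⊔ m ^ n := by
  have h1 : ∀ j, ∃ T0, ∀ T, J T0 ≤ J T ⊔ m ^ j := by
    intro j
    have := hart j
    obtain ⟨_, ⟨T0, rfl⟩, hmin⟩ := IsArtinian.set_has_minimal
      (Set.range fun T => (J T).map (Ideal.Quotient.mk (m ^ j))) ⟨_, ∅, rfl⟩
    refine ⟨T0, fun T => ?_⟩
    have h2 : (J (T0 ∪ T)).map (Ideal.Quotient.mk (m ^ j)) = (J T0).map (Ideal.Quotient.mk (m ^ j)) :=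
      eq_of_le_of_not_lt (Ideal.map_mono (hJ _ _ Finset.subset_union_left)) (hmin _ ⟨_, rfl⟩)
    have h3 : (J T0).map (Ideal.Quotient.mk (m ^ j)) ≤ (J T).map (Ideal.Quotient.mk (m ^ j)) := by
      rw [← h2]; exact Ideal.map_mono (hJ _ _ Finset.subset_union_right)
    rw [Ideal.map_le_iff_le_comap, Ideal.comap_map_of_surjective _ Ideal.Quotient.mk_surjective,
      ← RingHom.ker_eq_comap_bot, Ideal.mk_ker] at h3
    exact h3
  choose T hT using h1
  have step : ∀ n (x : J (T (k + n))), ∃ y : J (T (k + (n+1))), (y : R) - x ∈ m ^ (k + n) := by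
    rintro n ⟨x, hx⟩
    obtain ⟨y, hy, e, he, rfl⟩ := Submodule.mem_sup.1 (hT (k+n) (T (k + (n+1))) hx)
    refine ⟨⟨y, hy⟩, ?_⟩
    have : y - (y + e) = - e := by ring
    rw [this]; exact neg_mem he
  choose f hf using step
  obtain ⟨x0, hx0, hx0'⟩ := SetLike.not_le_iff_exists.1 (hk (T (k + 0)))
  let w : ∀ n, J (T (k + n)) := fun n => Nat.rec ⟨x0, hx0⟩ f n
  have hw : ∀ n : ℕ, (w (n+1)).1 - (w n).1 ∈ m ^ (k + n) := fun n => hf n (w n)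
  have hwk : ∀ n : ℕ, (w n).1 - x0 ∈ m ^ k := by
    intro n
    induction n with
    | zero => simp [w]
    | succ n ih =>
      have := add_mem (Ideal.pow_le_pow_right (Nat.le_add_right k n) (hw n)) ih
      simpa using this
  refine ⟨fun n => (w n).1, fun n => Ideal.pow_le_pow_right (Nat.le_add_left n k) (hw n), fun h => hx0' ?_, ?_⟩
  · have := sub_mem h (hwk k)
    simpa using this
  · intro n T'
    have hle : J T' ⊔ m ^ (k + n) ≤ J T' ⊔ m ^ n :=
      sup_le_sup_left (Ideal.pow_le_pow_right (Nat.le_add_left n k)) _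
    exact hle (hT (k+n) T' (w n).2)

end

section
section
open scoped TensorProduct
open IsLocalRing

theorem L9_main {R : Type u} [CommRing R] [IsLocalRing R] [IsNoetherianRing R]
    (H1 : ∀ p : Ideal R, p.IsPrime → (∀ x ∈ p, x ∉ nonZeroDivisors R) →
      ∃ p1 : Ideal R, p1.IsPrime ∧ p < p1 ∧ p1 < maximalIdeal R)
    (H2 : ∀ p : Ideal R, p.IsPrime → LIC.IsCatenaryRing (Polynomial (R ⧸ p)))
    (H3 : ∀ p : Ideal R, ∀ _ : p.IsPrime, LIC.IsRegularRing
      (FractionRing (R ⧸ p) ⊗[R] (AdicCompletion (maximalIdeal R) R)))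
    (k : ℕ) : ∃ T : Finset (R × R), ∀ z : R,
      (∀ t ∈ T, z * (t.1 * t.2) ∈ Ideal.span {t.1 ^ 2, t.2 ^ 2}) → z ∈ maximalIdeal R ^ k := by
  classical
  by_contra! hcon
  let J : Finset (R × R) → Ideal R := fun T => ⨅ t ∈ T,
    Submodule.comap (LinearMap.mulRight R (t.1 * t.2)) (Ideal.span {t.1 ^ 2, t.2 ^ 2})
  have hJmem : ∀ T z, z ∈ J T ↔ ∀ t ∈ T, z * (t.1 * t.2) ∈ Ideal.span {t.1 ^ 2, t.2 ^ 2} := by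
    intro T z
    simp [J, Submodule.mem_iInf, mul_assoc]
  obtain ⟨w, hw1, hw2, hw3⟩ := chev (maximalIdeal R) J
    (fun T T' hT z hz => (hJmem _ _).2 fun t ht => (hJmem _ _).1 hz t (hT ht)) art_pow k (by
      intro T hT
      obtain ⟨z, hz, hz'⟩ := hcon T
      exact hz' (hT ((hJmem _ _).2 hz)))
  let m := maximalIdeal R
  let S := AdicCompletion m R
  have : IsNoetherianRing S := noeth_compl _
  have : Module.Flat R S := AdicCompletion.flat_of_isNoetherian _
  let i := algebraMap R S
  have hmax : maximalIdeal S = m.map i := AdicCompletion.maximalIdeal_eq_map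
  have hin : ∀ a ∈ m, i a ∈ maximalIdeal S := fun a ha => by
    rw [hmax]; exact Ideal.mem_map_of_mem _ ha
  have hker : ∀ n x, AdicCompletion.evalₐ m n x = 0 → x ∈ maximalIdeal S ^ n := by
    intro n x hx
    rw [hmax]
    exact compl_ker m (IsNoetherian.noetherian _) n x hx
  have hei : ∀ n a, AdicCompletion.evalₐ m n (i a) = Ideal.Quotient.mk (m ^ n) a := fun n a =>
    (AdicCompletion.evalₐ m n).commutes a
  have hdense : ∀ (k : ℕ) (c : S), ∃ a : R, c - algebraMap R S a ∈ maximalIdeal S ^ k := by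
    intro k c
    obtain ⟨a, ha⟩ := Ideal.Quotient.mk_surjective (AdicCompletion.evalₐ m k c)
    refine ⟨a, hker _ _ ?_⟩
    rw [map_sub, hei, ha, sub_self]
  let W : AdicCompletion.AdicCauchySequence m R := AdicCompletion.AdicCauchySequence.mk m R w (by
    intro n
    apply SModEq.symm
    rw [SModEq.sub_mem]
    simpa using hw1 n)
  let z : S := AdicCompletion.mk m R W
  have hze : ∀ n, AdicCompletion.evalₐ m n z = Ideal.Quotient.mk (m ^ n) (w n) :=
    fun n => AdicCompletion.evalₐ_mk m n W
  have hz0 : z ≠ 0 := by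
    intro h
    have := hze k
    rw [h, map_zero] at this
    exact hw2 (Ideal.Quotient.eq_zero_iff_mem.1 this.symm)
  have hzab : ∀ a b : R, z * (i a * i b) ∈ Ideal.span {i a ^ 2, i b ^ 2} := by
    intro a b
    refine mem_of_forall_sup_pow _ _ fun n => ?_
    have h1 : z - i (w n) ∈ maximalIdeal S ^ n := hker _ _ (by rw [map_sub, hei, hze, sub_self])
    obtain ⟨x, hx, e, he, hxe⟩ := Submodule.mem_sup.1 (hw3 n {(a, b)})
    have h2 := (hJmem _ _).1 hx (a, b) (Finset.mem_singleton_self _)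
    obtain ⟨u, v, huv⟩ := Ideal.mem_span_pair.1 h2
    have h3 : i e ∈ maximalIdeal S ^ n := by
      rw [hmax, ← Ideal.map_pow]; exact Ideal.mem_map_of_mem _ he
    have h4 : z * (i a * i b) = i x * (i a * i b) + (i e + (z - i (w n))) * (i a * i b) := by
      rw [← hxe, map_add]; ring
    rw [h4]
    refine Ideal.add_mem _ (Ideal.mem_sup_left ?_) (Ideal.mem_sup_right ?_)
    · refine Ideal.mem_span_pair.2 ⟨i u, i v, ?_⟩
      have := congrArg i huv
      simpa using this
    · exact Ideal.mul_mem_right _ _ (add_mem h3 h1)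
  have : Nontrivial (Ideal.span {z} : Ideal S) :=
    ⟨⟨z, Ideal.mem_span_singleton_self z⟩, 0, fun h => hz0 (congrArg Subtype.val h)⟩
  obtain ⟨Q, hQ⟩ := associatedPrimes.nonempty S (Ideal.span {z} : Ideal S)
  rw [AssociatedPrimes.mem_iff, isAssociatedPrime_iff] at hQ
  obtain ⟨hQ, ⟨z', hz'⟩, hQz⟩ := hQ
  obtain ⟨c, rfl⟩ := Ideal.mem_span_singleton'.1 hz'
  have hann : ∀ s, s * (c * z) = 0 ↔ s ∈ Q := by
    intro s
    rw [hQz, Submodule.mem_colon_singleton, Submodule.mem_bot, Subtype.ext_iff]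
    rfl
  have hcz0 : c * z ≠ 0 := by
    intro h
    exact hQ.ne_top ((Ideal.eq_top_iff_one _).2 ((hann 1).1 (by rw [h, mul_zero])))
  obtain ⟨b, hbm, hb⟩ : ∃ b ∈ m, b ∈ nonZeroDivisors R := by
    by_contra! h
    obtain ⟨p1, _, h1, h2⟩ := H1 m inferInstance h
    exact (h1.trans h2).ne rfl
  obtain ⟨P0, hP0, h1, h2⟩ : ∃ P0 : Ideal S, P0.IsPrime ∧ Q < P0 ∧ P0 < maximalIdeal S := by
    by_contra! h
    refine L7_main hmax hdense H1 H2 H3 Q hQ (c * z) hann ?_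
    intro P hP hQP
    by_contra! h3
    exact h P hP (lt_of_le_of_ne hQP h3.1.symm) (lt_of_le_of_ne (le_maximalIdeal hP.ne_top) h3.2)
  refine L8_main hmax Q hQ (c * z) hann P0 hP0 h1 h2 b hbm ?_ (flat_nzd b hb) ?_
  · intro h
    exact hcz0 (flat_nzd b hb _ ((hann _).2 h))
  · intro a b
    rw [mul_assoc]
    exact Ideal.mul_mem_left _ _ (hzab a b)
end

end

section
section
open scoped TensorProduct
open IsLocalRing

theorem H1_of {R : Type u} [CommRing R] [IsLocalRing R] [IsNoetherianRing R]
    (hdim : 2 ≤ ringKrullDim R)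
    (hequi : LIC.IsEquidimensionalRing R)
    (hemb : LIC.HasNoEmbeddedPrimes R) (p : Ideal R) (hp : p.IsPrime)
    (hpz : ∀ x ∈ p, x ∉ nonZeroDivisors R) :
    ∃ p1 : Ideal R, p1.IsPrime ∧ p < p1 ∧ p1 < maximalIdeal R := by
  obtain ⟨P, hPa, hP⟩ : ∃ P ∈ associatedPrimes R R, p ≤ P :=
    (p.subset_union_prime_finite (associatedPrimes.finite ..) (f := id) 0 0 fun _ h _ _ ↦ h.1).1 <| by
      have := biUnion_associatedPrimes_eq_compl_nonZeroDivisors R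
      simp only [id]
      rw [this]
      exact hpz
  have hPm := hemb P hPa
  have hPp : p = P := le_antisymm hP (hPm.2 ⟨hp, bot_le⟩ hP)
  subst hPp
  have h2 := hdim
  rw [← hequi p hPm] at h2
  obtain ⟨l, hl⟩ := (Order.le_krullDim_iff (α := PrimeSpectrum (R ⧸ p)) (n := 2)).1 h2
  let q : Fin 3 → Ideal (R ⧸ p) := fun i => (l (Fin.cast (by rw [hl]) i)).asIdeal
  have hlt : ∀ i j, i < j → q i < q j := by
    intro i j hij
    exact l.strictMono (by simpa using hij)
  have hqp : ∀ i, (q i).IsPrime := fun i => (l _).2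
  have hc : ∀ I J : Ideal (R ⧸ p), I < J → I.comap (Ideal.Quotient.mk p) < J.comap (Ideal.Quotient.mk p) := by
    intro I J h
    refine lt_of_le_of_ne (Ideal.comap_mono h.le) fun h' => h.ne ?_
    exact Ideal.comap_injective_of_surjective _ Ideal.Quotient.mk_surjective h'
  have hp0 : p ≤ (q 0).comap (Ideal.Quotient.mk p) := by
    intro x hx
    rw [Ideal.mem_comap, Ideal.Quotient.eq_zero_iff_mem.2 hx]; exact zero_mem _
  refine ⟨(q 1).comap (Ideal.Quotient.mk p), Ideal.comap_isPrime _ _, ?_, ?_⟩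
  · exact lt_of_le_of_lt hp0 (hc _ _ (hlt 0 1 (by decide)))
  · exact lt_of_lt_of_le (hc _ _ (hlt 1 2 (by decide)))
      (le_maximalIdeal (Ideal.comap_isPrime (Ideal.Quotient.mk p) (q 2)).ne_top)

theorem H1_transport {R R' : Type u} [CommRing R] [CommRing R'] [IsLocalRing R] [IsLocalRing R']
    (e : R ≃+* R')
    (H1 : ∀ p : Ideal R, p.IsPrime → (∀ x ∈ p, x ∉ nonZeroDivisors R) →
      ∃ p1 : Ideal R, p1.IsPrime ∧ p < p1 ∧ p1 < maximalIdeal R)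
    (p : Ideal R') (hp : p.IsPrime) (hpz : ∀ x ∈ p, x ∉ nonZeroDivisors R') :
      ∃ p1 : Ideal R', p1.IsPrime ∧ p < p1 ∧ p1 < maximalIdeal R' := by
  obtain ⟨p1, h1, h2, h3⟩ := H1 (p.comap e.toRingHom) (Ideal.comap_isPrime _ _) (by
    intro x hx hx'
    refine hpz _ hx ?_
    rw [mem_nonZeroDivisors_iff_right] at hx' ⊢
    intro y hy
    have : e.symm y * x = 0 := by
      apply e.injective
      simpa using hy
    simpa using hx' _ this)
  have hp : (p.comap e.toRingHom).comap e.symm.toRingHom = p := by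
    ext x
    change e (e.symm x) ∈ p ↔ x ∈ p
    rw [e.apply_symm_apply]
  have hs : Function.Surjective e.symm.toRingHom := e.symm.surjective
  have hc : ∀ I J : Ideal R, I < J → I.comap e.symm.toRingHom < J.comap e.symm.toRingHom := by
    intro I J h
    refine lt_of_le_of_ne (Ideal.comap_mono h.le) fun h' => h.ne ?_
    exact Ideal.comap_injective_of_surjective _ hs h'
  refine ⟨p1.comap e.symm.toRingHom, Ideal.comap_isPrime _ _, ?_, ?_⟩
  · have := hc _ _ h2
    rwa [hp] at this
  · exact lt_of_lt_of_le (hc _ _ h3)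
      (le_maximalIdeal (Ideal.comap_isPrime e.symm.toRingHom (maximalIdeal R)).ne_top)

theorem fin_frac (A K : Type*) [CommRing A] [IsDomain A] [Field K] [Algebra A K] [IsFractionRing A K]
    [FaithfulSMul A K] :
    letI := FractionRing.liftAlgebra A K
    FiniteDimensional (FractionRing A) K := by
  letI := FractionRing.liftAlgebra A K
  have hs : ∀ x : K, ∃ c : FractionRing A, algebraMap _ _ c = x := by
    intro x
    obtain ⟨a, b, hb, rfl⟩ := IsFractionRing.div_surjective A x
    refine ⟨algebraMap _ _ a / algebraMap _ _ b, ?_⟩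
    rw [map_div₀, ← IsScalarTower.algebraMap_apply, ← IsScalarTower.algebraMap_apply]
  exact Module.Finite.of_surjective (Algebra.linearMap (FractionRing A) K) hs

theorem main_P {R : Type u} [CommRing R]
    [IsLocalRing R] [IsNoetherianRing R]
    (hexc : LIC.IsExcellentRing.{u} R)
    (hdim : 2 ≤ ringKrullDim R)
    (hequi : LIC.IsEquidimensionalRing R)
    (hemb : LIC.HasNoEmbeddedPrimes R) (k : ℕ) : ∃ T : Finset (R × R), ∀ z : R,
      (∀ t ∈ T, z * (t.1 * t.2) ∈ Ideal.span {t.1 ^ 2, t.2 ^ 2}) → z ∈ maximalIdeal R ^ k := by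
  classical
  let R' := Localization.AtPrime (maximalIdeal R)
  let e : R ≃ₐ[R] R' := IsLocalization.atUnits R (maximalIdeal R).primeCompl (by
    intro x hx
    by_contra h
    exact hx h)
  have : IsNoetherianRing R' := IsLocalization.isNoetherianRing (maximalIdeal R).primeCompl R' inferInstance
  have hL9 := L9_main (R := R') (H1_transport e.toRingEquiv (H1_of hdim hequi hemb)) ?_ ?_ k
  · obtain ⟨T, hT⟩ := hL9
    refine ⟨T.image fun t => (e.symm t.1, e.symm t.2), fun z hz => ?_⟩
    have h1 : e z ∈ maximalIdeal R' ^ k := by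
      apply hT
      intro t ht
      obtain ⟨u, v, huv⟩ := Ideal.mem_span_pair.1 (hz _ (Finset.mem_image_of_mem _ ht))
      refine Ideal.mem_span_pair.2 ⟨e u, e v, ?_⟩
      simpa using congrArg e huv
    rw [← Localization.AtPrime.map_eq_maximalIdeal, ← Ideal.map_pow,
      Ideal.mem_map_iff_of_surjective (algebraMap R R') (fun x => ⟨e.symm x, by
        rw [← e.commutes]; simp⟩)] at h1
    obtain ⟨x, hx, hxz⟩ := h1
    have : e x = e z := by rw [← hxz]; exact e.commutes x
    rwa [← e.injective this]
  · intro p hp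
    refine hexc.2.1 (Polynomial (R' ⧸ p)) inferInstance inferInstance ?_
    have h1 : Algebra.FiniteType R R' := Algebra.FiniteType.equiv inferInstance e
    have h2 : Algebra.FiniteType R' (Polynomial (R' ⧸ p)) :=
      Algebra.FiniteType.trans (inferInstance : Algebra.FiniteType R' (R' ⧸ p)) inferInstance
    exact Algebra.FiniteType.trans h1 h2
  · intro p hp
    have hnz : NoZeroSMulDivisors (R' ⧸ p) (FractionRing (R' ⧸ p)) := by
      constructor
      intro c x h
      rw [Algebra.smul_def, mul_eq_zero] at h
      exact h.imp_left fun h => IsFractionRing.injective (R' ⧸ p) (FractionRing (R' ⧸ p)) (h.trans (map_zero _).symm)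
    refine hexc.2.2.1 (maximalIdeal R) inferInstance p hp (FractionRing (R' ⧸ p)) inferInstance inferInstance hnz inferInstance inferInstance ?_
    exact fin_frac (R' ⧸ p) (FractionRing (R' ⧸ p))
end

end

section
theorem killed {R M : Type*} [CommRing R] [IsLocalRing R] [IsNoetherianRing R] [AddCommGroup M]
    [Module R M] [IsArtinian R M] (x : M) :
    ∃ k : ℕ, ∀ r ∈ IsLocalRing.maximalIdeal R ^ k, r • x = 0 := by
  let m := IsLocalRing.maximalIdeal R
  let f : ℕ →o (Submodule R M)ᵒᵈ := ⟨fun n => OrderDual.toDual (m ^ n • Submodule.span R {x}), by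
    intro n n' h
    exact Submodule.smul_mono_left (Ideal.pow_le_pow_right h)⟩
  obtain ⟨k, hk⟩ := IsArtinian.monotone_stabilizes f
  have hk1 : m ^ k • Submodule.span R {x} = m ^ (k+1) • Submodule.span R {x} := hk (k+1) (Nat.le_succ k)
  have hfg : (m ^ k • Submodule.span R {x}).FG :=
    isNoetherian_submodule.1 (isNoetherian_span_of_finite R (Set.finite_singleton x)) _ Submodule.smul_le_right
  have hbot : m ^ k • Submodule.span R {x} = ⊥ := by
    refine Submodule.eq_bot_of_le_smul_of_le_jacobson_bot m _ hfg ?_ (IsLocalRing.maximalIdeal_le_jacobson _)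
    rw [← Submodule.mul_smul, ← pow_succ', ← hk1]
  refine ⟨k, fun r hr => ?_⟩
  rw [← Submodule.mem_bot R, ← hbot]
  exact Submodule.smul_mem_smul hr (Submodule.mem_span_singleton_self x)

theorem mem_freeIC_sq {R ι : Type*} [CommRing R] (L : Submodule R (ι →₀ R)) (i : ι) (a b : R)
    (ha : Finsupp.single i (a ^ 2) ∈ L) (hb : Finsupp.single i (b ^ 2) ∈ L) :
    Finsupp.single i (a * b) ∈ LIC.freeIC L := by
  change IsIntegral (Algebra.adjoin R (LIC.symEmb R ι '' L)) (LIC.symEmb R ι (Finsupp.single i (a * b)))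
  have hs : ∀ r : R, LIC.symEmb R ι (Finsupp.single i r) = MvPolynomial.C r * MvPolynomial.X i := by
    intro r
    simp [LIC.symEmb, MvPolynomial.smul_eq_C_mul]
  refine IsIntegral.of_pow (n := 2) (by norm_num) ?_
  have h1 : LIC.symEmb R ι (Finsupp.single i (a * b)) ^ 2 =
      LIC.symEmb R ι (Finsupp.single i (a ^ 2)) * LIC.symEmb R ι (Finsupp.single i (b ^ 2)) := by
    rw [hs, hs, hs, map_mul, map_pow, map_pow]; ring
  rw [h1]
  have h2 : ∀ v ∈ L, IsIntegral (Algebra.adjoin R (LIC.symEmb R ι '' L)) (LIC.symEmb R ι v) := by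
    intro v hv
    exact isIntegral_algebraMap (R := Algebra.adjoin R (LIC.symEmb R ι '' L))
      (x := ⟨LIC.symEmb R ι v, Algebra.subset_adjoin ⟨v, hv, rfl⟩⟩)
  exact (h2 _ ha).mul (h2 _ hb)

theorem le_freeIC {R ι : Type*} [CommRing R] (L : Submodule R (ι →₀ R)) : L ≤ LIC.freeIC L := by
  intro v hv
  exact isIntegral_algebraMap (R := Algebra.adjoin R (LIC.symEmb R ι '' L))
      (x := ⟨LIC.symEmb R ι v, Algebra.subset_adjoin ⟨v, hv, rfl⟩⟩)

theorem L10_quot {R M N F : Type*} [CommRing R] [AddCommGroup M] [Module R M] [AddCommGroup N]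
    [Module R N] [AddCommGroup F] [Module R F] (Ψ : N →ₗ[R] F) (φ0 : N →ₗ[R] M)
    (hφ0 : Function.Surjective φ0) (L T : Submodule R F) (hΨT : ∀ c, Ψ c ∈ T)
    (hkey : ∀ c, Ψ c ∈ L ↔ c ∈ LinearMap.ker φ0) (hT : ∀ y ∈ T, ∃ c, Ψ c - y ∈ L) :
    ∃ φ : ↥T →ₗ[R] M, Function.Surjective φ ∧
        LinearMap.ker φ = Submodule.comap T.subtype L := by
  let Ψ' : N →ₗ[R] T := Ψ.codRestrict T hΨT
  let L' : Submodule R T := Submodule.comap T.subtype L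
  let h : N →ₗ[R] (T ⧸ L') := L'.mkQ ∘ₗ Ψ'
  have hsurj : Function.Surjective h := by
    intro y
    obtain ⟨⟨y, hy⟩, rfl⟩ := L'.mkQ_surjective y
    obtain ⟨c, hc⟩ := hT y hy
    refine ⟨c, ?_⟩
    exact (Submodule.Quotient.eq L').2 hc
  have hker : LinearMap.ker h = LinearMap.ker φ0 := by
    ext c
    rw [← hkey, LinearMap.mem_ker]
    exact Submodule.Quotient.mk_eq_zero L'
  let e : (T ⧸ L') ≃ₗ[R] M := (h.quotKerEquivOfSurjective hsurj).symm ≪≫ₗ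
    (Submodule.quotEquivOfEq _ _ hker) ≪≫ₗ (φ0.quotKerEquivOfSurjective hφ0)
  refine ⟨e.toLinearMap ∘ₗ L'.mkQ, ?_, ?_⟩
  · exact e.surjective.comp L'.mkQ_surjective
  · rw [LinearEquiv.ker_comp, Submodule.ker_mkQ]

theorem L10_main {R M X ι : Type*} [CommRing R] [AddCommGroup M] [Module R M] (g : X → M)
    (hg : Submodule.span R (Set.range g) = ⊤) (π : ι → X) (hfin : ∀ x, {i | π i = x}.Finite)
    (a b : ι → R)
    (hk : ∀ x z, (∀ i, π i = x → z * (a i * b i) ∈ Ideal.span {a i ^ 2, b i ^ 2}) → z • g x = 0) :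
    ∃ (L T : Submodule R (ι →₀ R)), L ≤ T ∧ T ≤ LIC.freeIC L ∧
      ∃ φ : ↥T →ₗ[R] M, Function.Surjective φ ∧
        LinearMap.ker φ = Submodule.comap T.subtype L := by
  classical
  let uu : X → (ι →₀ R) := fun x => ∑ i ∈ (hfin x).toFinset, Finsupp.single i (a i * b i)
  have huu : ∀ x i, uu x i = if π i = x then a i * b i else 0 := by
    intro x i
    simp only [uu, Finsupp.finset_sum_apply, Finsupp.single_apply]
    rw [Finset.sum_ite_eq']
    simp
  let Ψ : (X →₀ R) →ₗ[R] (ι →₀ R) := Finsupp.linearCombination R uu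
  let φ0 : (X →₀ R) →ₗ[R] M := Finsupp.linearCombination R g
  have hφ0 : Function.Surjective φ0 := by
    rw [← LinearMap.range_eq_top, Finsupp.range_linearCombination, hg]
  have hΨ : ∀ c i, Ψ c i = c (π i) * (a i * b i) := by
    intro c i
    simp only [Ψ, Finsupp.linearCombination_apply, Finsupp.sum, Finsupp.finset_sum_apply,
      Finsupp.smul_apply, huu, smul_eq_mul, mul_ite, mul_zero]
    rw [Finset.sum_ite_eq]
    split_ifs with h
    · rfl
    · rw [Finsupp.notMem_support_iff.1 h, zero_mul]
  let L0 : Submodule R (ι →₀ R) :=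
    ⨅ i, Submodule.comap (Finsupp.lapply i) (Ideal.span {a i ^ 2, b i ^ 2} : Ideal R)
  have hL0 : ∀ v, v ∈ L0 ↔ ∀ i, v i ∈ Ideal.span {a i ^ 2, b i ^ 2} := by
    intro v
    simp [L0, Submodule.mem_iInf]
  have hL0s : ∀ i r, r ∈ Ideal.span {a i ^ 2, b i ^ 2} → Finsupp.single i r ∈ L0 := by
    intro i r hr
    rw [hL0]
    intro j
    rw [Finsupp.single_apply]
    split_ifs with h
    · subst h; exact hr
    · exact zero_mem _
  let L := L0 ⊔ Submodule.map Ψ (LinearMap.ker φ0)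
  let T := L0 ⊔ LinearMap.range Ψ
  have hL0L : L0 ≤ L := le_sup_left
  have hLT : L ≤ T := sup_le_sup_left (LinearMap.map_le_range) _
  have hkey : ∀ c, Ψ c ∈ L ↔ c ∈ LinearMap.ker φ0 := by
    intro c
    constructor
    · intro hc
      obtain ⟨l, hl, _, ⟨c', hc', rfl⟩, hsum⟩ := Submodule.mem_sup.1 hc
      have h1 : Ψ (c - c') ∈ L0 := by
        have : Ψ (c - c') = l := by rw [map_sub, ← hsum]; abel
        rw [this]; exact hl
      have h2 : φ0 (c - c') = 0 := by
        rw [Finsupp.linearCombination_apply, Finsupp.sum]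
        refine Finset.sum_eq_zero fun x _ => hk x _ ?_
        rintro i rfl
        rw [← hΨ]
        exact (hL0 _).1 h1 i
      rw [map_sub, LinearMap.mem_ker.1 hc', sub_zero] at h2
      exact h2
    · intro hc
      exact Submodule.mem_sup_right ⟨c, hc, rfl⟩
  refine ⟨L, T, hLT, sup_le (hL0L.trans (le_freeIC L)) ?_, ?_⟩
  · rw [Finsupp.range_linearCombination, Submodule.span_le]
    rintro _ ⟨x, rfl⟩
    refine sum_mem fun i _ => mem_freeIC_sq L i _ _ (hL0L (hL0s i _ ?_)) (hL0L (hL0s i _ ?_))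
    · exact Ideal.subset_span (by simp)
    · exact Ideal.subset_span (by simp)
  · refine L10_quot Ψ φ0 hφ0 L T (fun c => Submodule.mem_sup_right ⟨c, rfl⟩) hkey ?_
    intro y hy
    obtain ⟨l, hl, _, ⟨c, rfl⟩, hsum⟩ := Submodule.mem_sup.1 hy
    refine ⟨c, ?_⟩
    have : Ψ c - y = - l := by rw [← hsum]; abel
    rw [this]
    exact neg_mem (hL0L hl)

end

/-- Let `R` be an excellent Noetherian local ring of dimension at least
`2`, equidimensional with no embedded primes, and let `M` be an Artinian `R`-module.
Then there are a free module `F` and submodules `L ⊆ T ⊆ F` (so `L`, `T` are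
torsionless) with `M ≅ T/L` (expressed by a surjection `T → M` with kernel `L`) and `T`
contained in the integral closure `L⁻_F` of `L` in `F`.  If moreover `M` is finitely
generated (hence of finite length), then `F`, `T`, `L` can be chosen finitely
generated. -/
theorem artinian_is_quotient_of_integral_torsionless {R : Type u} [CommRing R]
    [IsLocalRing R] [IsNoetherianRing R]
    (hexc : LIC.IsExcellentRing.{u} R)
    (hdim : 2 ≤ ringKrullDim R)
    (hequi : LIC.IsEquidimensionalRing R)
    (hemb : LIC.HasNoEmbeddedPrimes R)
    (M : Type u) [AddCommGroup M] [Module R M] [IsArtinian R M] :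
    (∃ (ι : Type u) (L T : Submodule R (ι →₀ R)), L ≤ T ∧ T ≤ LIC.freeIC L ∧
      ∃ φ : ↥T →ₗ[R] M, Function.Surjective φ ∧
        LinearMap.ker φ = Submodule.comap T.subtype L) ∧
    (Module.Finite R M →
      ∃ (n : ℕ) (L T : Submodule R (Fin n →₀ R)), L ≤ T ∧ T ≤ LIC.freeIC L ∧
        L.FG ∧ T.FG ∧ ∃ φ : ↥T →ₗ[R] M, Function.Surjective φ ∧
          LinearMap.ker φ = Submodule.comap T.subtype L) := by
  choose k hk using fun x : M => killed (R := R) x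
  choose T hT using fun n : ℕ => main_P (R := R) hexc hdim hequi hemb n
  refine ⟨?_, ?_⟩
  · refine ⟨Σ x : M, {t : R × R // t ∈ T (k x)}, ?_⟩
    refine L10_main (R := R) (id : M → M) (by simp) (fun i => i.1) ?_
      (fun i => i.2.1.1) (fun i => i.2.1.2) ?_
    · intro x
      refine (Set.finite_range (fun t : {t : R × R // t ∈ T (k x)} =>
        (⟨x, t⟩ : Σ x : M, {t : R × R // t ∈ T (k x)}))).subset ?_
      rintro ⟨y, t⟩ rfl
      exact ⟨t, rfl⟩
    · intro x z h
      exact hk x z (hT _ z fun t ht => h ⟨x, t, ht⟩ rfl)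
  · intro hfin
    obtain ⟨n, g, hg⟩ := Submodule.fg_iff_exists_fin_generating_family.1 hfin.fg_top
    let e := Fintype.equivFin (Σ j : Fin n, {t : R × R // t ∈ T (k (g j))})
    refine ⟨Fintype.card (Σ j : Fin n, {t : R × R // t ∈ T (k (g j))}), ?_⟩
    obtain ⟨L, T', h1, h2, h3⟩ := L10_main (R := R) g hg (fun i => (e.symm i).1)
      (fun x => Set.toFinite _) (fun i => (e.symm i).2.1.1) (fun i => (e.symm i).2.1.2) (by
        intro x z h
        refine hk (g x) z (hT _ z fun t ht => ?_)
        have hv : ((e.symm (e ⟨x, t, ht⟩)).2.1 : R × R) = t :=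
          congrArg (fun s : (Σ j : Fin n, {t : R × R // t ∈ T (k (g j))}) => (s.2.1 : R × R))
            (e.symm_apply_apply ⟨x, t, ht⟩)
        have := h (e ⟨x, t, ht⟩) (by simp)
        rw [hv] at this
        exact this)
    exact ⟨L, T', h1, h2, IsNoetherian.noetherian _, IsNoetherian.noetherian _, h3⟩
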